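/- arXiv:2605.07107 — 2 statements merged into one kernel-verified Lean document; each statement's English description precedes it below -/
import Mathlib

section
/- Under Assumptions 1 and 2, Z_n converges in distribution to a standard Gaussian random variable Z ~ N(0,1) as n → ∞ (equivalently, the laws of Z_n converge weakly to the standard Gaussian measure on ℝ). -/
open MeasureTheory ProbabilityTheory Filter Real Set

/-- A real random variable has sub-Gaussian tails. -/
def SubGaussianTail {Ω : Type*} [MeasurableSpace Ω] (P : Measure Ω) (W : Ω → ℝ) : Prop :=
  ∃ C > 0, ∃ c > 0, ∀ t > 0,
    P {ω | t ≤ |W ω|} ≤ ENNReal.ofReal (C * Real.exp (-c * t ^ 2))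

/-- A real random variable has sub-exponential tails. -/
def SubExponentialTail {Ω : Type*} [MeasurableSpace Ω] (P : Measure Ω) (W : Ω → ℝ) : Prop :=
  ∃ C > 0, ∃ c > 0, ∀ t > 0,
    P {ω | t ≤ |W ω|} ≤ ENNReal.ofReal (C * Real.exp (-c * t))

lemma subG_subE {Ω : Type*} [MeasurableSpace Ω] (P : Measure Ω) (W : Ω → ℝ)
    (h : SubGaussianTail P W) : SubExponentialTail P W := by
  obtain ⟨C, hC, c, hc, h⟩ := h
  refine ⟨C * exp c, by positivity, 2 * c, by positivity, fun t ht => (h t ht).trans ?_⟩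
  apply ENNReal.ofReal_le_ofReal
  rw [mul_assoc, ← exp_add]
  gcongr
  nlinarith [mul_nonneg hc.le (sq_nonneg (t - 1))]

lemma exp_integrable {Ω : Type*} [MeasurableSpace Ω] (P : Measure Ω) [IsProbabilityMeasure P]
    (V W : Ω → ℝ) (hV : SubExponentialTail P V) (hW : AEMeasurable W P) (hW0 : ∀ᵐ ω ∂P, 0 ≤ W ω)
    (hWV : ∀ᵐ ω ∂P, W ω ≤ |V ω|) : ∃ lam > 0, Integrable (fun ω => exp (lam * W ω)) P := by
  obtain ⟨C, hC, c, hc, h⟩ := hV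
  refine ⟨c / 2, by positivity, ?_⟩
  have key := lintegral_comp_eq_lintegral_meas_le_mul (g := fun t => c / 2 * exp (c / 2 * t)) P
    hW0 hW (fun t _ => Continuous.intervalIntegrable (by fun_prop) _ _)
    (Eventually.of_forall fun t => by positivity)
  have hinteg : ∀ y, ∫ t in (0 : ℝ)..y, c / 2 * exp (c / 2 * t) = exp (c / 2 * y) - 1 := by
    intro y
    rw [intervalIntegral.integral_eq_sub_of_hasDerivAt (f := fun t => exp (c / 2 * t))]
    · simp
    · intro x _
      have := ((hasDerivAt_id x).const_mul (c / 2)).exp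
      simpa [mul_comm] using this
    · exact Continuous.intervalIntegrable (by fun_prop) _ _
  simp only [hinteg] at key
  have hfin : ∫⁻ t in Ioi (0 : ℝ), P {a | t ≤ W a} * ENNReal.ofReal (c / 2 * exp (c / 2 * t)) < ⊤ := by
    have hI : IntegrableOn (fun t => C * (c / 2) * exp (-(c / 2) * t)) (Ioi 0) :=
      (exp_neg_integrableOn_Ioi 0 (by positivity : 0 < c / 2)).const_mul _
    refine lt_of_le_of_lt ?_ hI.lintegral_lt_top
    refine setLIntegral_mono (by fun_prop) fun t ht => ?_
    have h1 : P {a | t ≤ W a} ≤ ENNReal.ofReal (C * exp (-c * t)) := by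
      refine le_trans (measure_mono_ae ?_) (h t ht)
      filter_upwards [hWV] with ω hω h1
      exact le_trans h1 hω
    calc _ ≤ ENNReal.ofReal (C * exp (-c * t)) * ENNReal.ofReal (c / 2 * exp (c / 2 * t)) := by
          gcongr
      _ = _ := by
        rw [← ENNReal.ofReal_mul (by positivity)]
        congr 1
        rw [show -(c / 2) * t = -c * t + c / 2 * t by ring, exp_add]
        ring
  have hi : Integrable (fun ω => exp (c / 2 * W ω) - 1) P := by
    refine ⟨((hW.const_mul _).exp.sub_const 1).aestronglyMeasurable, ?_⟩
    rw [hasFiniteIntegral_iff_ofReal, key]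
    · exact hfin
    · filter_upwards [hW0] with ω hω
      have : 0 ≤ c / 2 * W ω := by positivity
      simpa using this
  refine (hi.add (integrable_const (1 : ℝ))).congr (Eventually.of_forall fun ω => ?_)
  simp

lemma aem_deriv {𝓧 : Type*} [MeasurableSpace 𝓧] (μ : Measure 𝓧) (Θ : Set ℝ) (hΘ : IsOpen Θ)
    (φ : ℝ → 𝓧 → ℝ) (hφ : ∀ θ ∈ Θ, AEMeasurable (φ θ) μ) (θ : ℝ) (hθ : θ ∈ Θ)
    (hd : ∀ᵐ x ∂μ, DifferentiableAt ℝ (fun t => φ t x) θ) :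
    AEMeasurable (fun x => deriv (fun t => φ t x) θ) μ := by
  classical
  refine aemeasurable_of_tendsto_metrizable_ae (nhdsWithin θ {θ}ᶜ)
    (f := fun t x => if t ∈ Θ then slope (fun t => φ t x) θ t else 0) ?_ ?_
  · intro t
    by_cases ht : t ∈ Θ
    · simp only [ht, if_true, slope_def_field]
      exact ((hφ t ht).sub (hφ θ hθ)).div_const _
    · simp only [ht, if_false]
      fun_prop
  · filter_upwards [hd] with x hx
    refine (hasDerivAt_iff_tendsto_slope.1 hx.hasDerivAt).congr' ?_
    filter_upwards [nhdsWithin_le_nhds (hΘ.mem_nhds hθ)] with t ht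
    simp [ht]

lemma envelopeA {𝓧 : Type*} [MeasurableSpace 𝓧] (K : Set ℝ) (hK : K.Nonempty)
    (ℓ : ℝ → 𝓧 → ℝ) (hm : ∀ θ ∈ K, Measurable (ℓ θ)) (H : 𝓧 → ℝ) (hH0 : ∀ x, 0 ≤ H x)
    (hH : ∀ x, ∀ θ ∈ K, ∀ θ' ∈ K, |ℓ θ x - ℓ θ' x| ≤ H x * |θ - θ'|) :
    ∃ H' : 𝓧 → ℝ, Measurable H' ∧ (∀ x, 0 ≤ H' x) ∧ (∀ x, H' x ≤ H x) ∧
      (∀ x, ∀ θ ∈ K, ∀ θ' ∈ K, |ℓ θ x - ℓ θ' x| ≤ H' x * |θ - θ'|) := by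
  have : Nonempty K := hK.to_subtype
  let d := TopologicalSpace.denseSeq K
  have hd : DenseRange d := TopologicalSpace.denseRange_denseSeq K
  let q : 𝓧 → ℕ × ℕ → ℝ := fun x p => |ℓ (d p.1) x - ℓ (d p.2) x| / |(d p.1 : ℝ) - d p.2|
  have hq : ∀ x p, q x p ≤ H x := by
    intro x p
    apply div_le_of_le_mul₀ (abs_nonneg _) (hH0 x)
    exact hH x _ (d p.1).2 _ (d p.2).2
  have hbdd : ∀ x, BddAbove (range (q x)) := fun x => ⟨H x, by rintro _ ⟨p, rfl⟩; exact hq x p⟩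
  refine ⟨fun x => ⨆ p, q x p, ?_, ?_, ?_, ?_⟩
  · refine Measurable.iSup fun p => ?_
    have h1 := hm _ (d p.1).2
    have h2 := hm _ (d p.2).2
    simp only [q]
    exact (measurable_norm.comp (h1.sub h2)).div_const _
  · exact fun x => Real.iSup_nonneg fun p => by positivity
  · exact fun x => ciSup_le (hq x)
  · intro x θ hθ θ' hθ'
    have hcont : Continuous (fun θ : K => ℓ θ x) := by
      have : LipschitzWith (H x).toNNReal (fun θ : K => ℓ θ x) := by
        refine LipschitzWith.of_dist_le_mul fun a b => ?_
        rw [Real.dist_eq, Subtype.dist_eq, Real.dist_eq, Real.coe_toNNReal _ (hH0 x)]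
        exact hH x _ a.2 _ b.2
      exact this.continuous
    have hd2 : DenseRange (fun p : ℕ × ℕ => (d p.1, d p.2)) := hd.prodMap hd
    have hcl : IsClosed {p : K × K | |ℓ p.1 x - ℓ p.2 x| ≤ (⨆ p, q x p) * |(p.1 : ℝ) - p.2|} := by
      apply isClosed_le
      · exact ((hcont.comp continuous_fst).sub (hcont.comp continuous_snd)).abs
      · fun_prop
    have hall := hd2.induction_on (p := fun p : K × K => |ℓ p.1 x - ℓ p.2 x| ≤ (⨆ p, q x p) * |(p.1 : ℝ) - p.2|)
      (⟨θ, hθ⟩, ⟨θ', hθ'⟩) hcl (by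
        intro p
        by_cases h0 : (d p.1 : ℝ) = d p.2
        · simp [h0]
        · have : 0 < |(d p.1 : ℝ) - d p.2| := abs_pos.2 (sub_ne_zero.2 h0)
          rw [← div_le_iff₀ this]
          exact le_ciSup (hbdd x) p)
    exact hall

lemma gibbs {𝓧 : Type*} [MeasurableSpace 𝓧] (ν : Measure 𝓧) [IsProbabilityMeasure ν]
    (u : 𝓧 → ℝ) (hu : Integrable u ν) (he : Integrable (fun x => exp (u x)) ν)
    (h1 : ∫ x, exp (u x) ∂ν = 1) (h : 0 ≤ ∫ x, u x ∂ν) : u =ᵐ[ν] 0 := by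
  have hnn : ∀ x, 0 ≤ exp (u x) - (u x + 1) := fun x => by linarith [add_one_le_exp (u x)]
  have hi : Integrable (fun x => exp (u x) - (u x + 1)) ν := he.sub (hu.add (integrable_const _))
  have hinteg : ∫ x, exp (u x) - (u x + 1) ∂ν = - ∫ x, u x ∂ν := by
    have e1 : ∫ x, u x + 1 ∂ν = ∫ x, u x ∂ν + 1 := by
      rw [integral_add hu (integrable_const _)]; simp
    have hu1 : Integrable (fun x => u x + 1) ν := hu.add (integrable_const _)
    rw [integral_sub he hu1, e1, h1]
    ring
  have h0 : ∫ x, exp (u x) - (u x + 1) ∂ν = 0 :=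
    le_antisymm (by linarith) (integral_nonneg hnn)
  have := (integral_eq_zero_iff_of_nonneg hnn hi).1 h0
  filter_upwards [this] with x hx
  by_contra hne
  have := add_one_lt_exp (x := u x) hne
  simp at hx
  linarith

lemma envelopeG {𝓧 : Type*} [MeasurableSpace 𝓧] (μ : Measure 𝓧) (Θ : Set ℝ) (hΘ : IsOpen Θ)
    (ℓ : ℝ → 𝓧 → ℝ) (hm : ∀ θ ∈ Θ, Measurable (ℓ θ))
    (hsm : ∀ᵐ x ∂μ, (∀ θ ∈ Θ, DifferentiableAt ℝ (fun t => ℓ t x) θ) ∧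
      (∀ θ ∈ Θ, DifferentiableAt ℝ (deriv (fun t => ℓ t x)) θ))
    (θ₀ : ℝ) (r : ℝ) (hr : 0 < r) (hball : Metric.ball θ₀ r ⊆ Θ)
    (Hbar : 𝓧 → ℝ) (hH0 : ∀ x, 0 ≤ Hbar x)
    (hH : ∀ x, ∀ θ ∈ Metric.ball θ₀ r, |deriv (deriv (fun t => ℓ t x)) θ₀
      - deriv (deriv (fun t => ℓ t x)) θ| ≤ Hbar x * |θ - θ₀|) :
    ∃ a b G : 𝓧 → ℝ, Measurable a ∧ Measurable b ∧ Measurable G ∧ (∀ x, 0 ≤ G x) ∧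
      ∀ᵐ x ∂μ, a x = deriv (fun t => ℓ t x) θ₀ ∧ b x = deriv (deriv (fun t => ℓ t x)) θ₀ ∧
        G x ≤ Hbar x ∧
        (∀ θ ∈ Metric.ball θ₀ r, |deriv (fun t => ℓ t x) θ - a x - b x * (θ - θ₀)|
          ≤ G x * (θ - θ₀) ^ 2) ∧
        (∀ h, |h| < r → |ℓ (θ₀ + h) x - ℓ θ₀ x - a x * h - b x * h ^ 2 / 2| ≤ G x * |h| ^ 3) := by
  have hθ₀ : θ₀ ∈ Θ := hball (Metric.mem_ball_self hr)
  have hs : ∀ θ ∈ Θ, AEMeasurable (fun x => deriv (fun t => ℓ t x) θ) μ := fun θ hθ =>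
    aem_deriv μ Θ hΘ ℓ (fun θ hθ => (hm θ hθ).aemeasurable) θ hθ
      (hsm.mono fun x hx => hx.1 θ hθ)
  have hs' : AEMeasurable (fun x => deriv (deriv (fun t => ℓ t x)) θ₀) μ :=
    aem_deriv μ Θ hΘ (fun θ x => deriv (fun t => ℓ t x) θ) hs θ₀ hθ₀
      (hsm.mono fun x hx => hx.2 θ₀ hθ₀)
  have : Nonempty (Metric.ball θ₀ r) := ⟨⟨θ₀, Metric.mem_ball_self hr⟩⟩
  let d := TopologicalSpace.denseSeq (Metric.ball θ₀ r)
  have hd : DenseRange d := TopologicalSpace.denseRange_denseSeq _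
  have hsd : ∀ n, AEMeasurable (fun x => deriv (fun t => ℓ t x) (d n)) μ := fun n =>
    hs _ (hball (d n).2)
  let a := (hs θ₀ hθ₀).mk
  let b := hs'.mk
  let q : 𝓧 → ℕ → ℝ := fun x n => |(hsd n).mk _ x - a x - b x * (d n - θ₀)| / ((d n : ℝ) - θ₀) ^ 2
  refine ⟨a, b, fun x => ⨆ n, q x n, (hs θ₀ hθ₀).measurable_mk, hs'.measurable_mk, ?_, ?_, ?_⟩
  · refine Measurable.iSup fun n => ?_
    have h1 := (hsd n).measurable_mk
    have h2 : Measurable a := (hs θ₀ hθ₀).measurable_mk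
    have h3 : Measurable b := hs'.measurable_mk
    exact (measurable_norm.comp ((h1.sub h2).sub (h3.mul_const _))).div_const _
  · exact fun x => Real.iSup_nonneg fun n => by positivity
  have hall : ∀ᵐ x ∂μ, ∀ n, deriv (fun t => ℓ t x) (d n) = (hsd n).mk _ x :=
    ae_all_iff.2 fun n => (hsd n).ae_eq_mk
  filter_upwards [hsm, hall, (hs θ₀ hθ₀).ae_eq_mk, hs'.ae_eq_mk] with x hx hxd hxa hxb
  change _ = a x at hxa
  change _ = b x at hxb
  have hsub : ∀ θ ∈ Metric.ball θ₀ r, Metric.closedBall θ₀ |θ - θ₀| ⊆ Metric.ball θ₀ r := by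
    intro θ hθ
    apply Metric.closedBall_subset_ball
    simpa [Real.dist_eq] using hθ
  have htay : ∀ θ ∈ Metric.ball θ₀ r, |deriv (fun t => ℓ t x) θ - a x - b x * (θ - θ₀)|
      ≤ Hbar x * (θ - θ₀) ^ 2 := by
    intro θ hθ
    have hD : ∀ t ∈ Metric.closedBall θ₀ |θ - θ₀|, HasDerivWithinAt
        (fun t => deriv (fun t => ℓ t x) t - b x * (t - θ₀))
        (deriv (deriv (fun t => ℓ t x)) t - b x) (Metric.closedBall θ₀ |θ - θ₀|) t := by
      intro t ht
      have h1 := (hx.2 t (hball (hsub θ hθ ht))).hasDerivAt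
      have h2 := ((hasDerivAt_id t).sub_const θ₀).const_mul (b x)
      refine (h1.sub h2).hasDerivWithinAt.congr_deriv ?_
      simp
    have := Convex.norm_image_sub_le_of_norm_hasDerivWithin_le hD (C := Hbar x * |θ - θ₀|) (by
      intro t ht
      have h1 := hH x t (hsub θ hθ ht)
      rw [hxb, abs_sub_comm] at h1
      refine h1.trans ?_
      have : |t - θ₀| ≤ |θ - θ₀| := by simpa [Real.dist_eq] using ht
      have := hH0 x
      gcongr) (convex_closedBall _ _) (x := θ₀) (y := θ) (by simp) (by simp [Real.dist_eq])
    simp only [sub_self, mul_zero, sub_zero, Real.norm_eq_abs, hxa] at this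
    calc _ = |deriv (fun t => ℓ t x) θ - b x * (θ - θ₀) - a x| := by congr 1; ring
      _ ≤ _ := this
      _ = _ := by rw [mul_assoc, ← sq, sq_abs]
  have hq : ∀ n, q x n ≤ Hbar x := by
    intro n
    apply div_le_of_le_mul₀ (sq_nonneg _) (hH0 x)
    rw [← hxd]
    exact htay _ (d n).2
  have hbdd : BddAbove (range (q x)) := ⟨Hbar x, by rintro _ ⟨p, rfl⟩; exact hq p⟩
  have hG : ∀ θ ∈ Metric.ball θ₀ r, |deriv (fun t => ℓ t x) θ - a x - b x * (θ - θ₀)|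
      ≤ (⨆ n, q x n) * (θ - θ₀) ^ 2 := by
    intro θ hθ
    have hcont : Continuous (fun t : Metric.ball θ₀ r => deriv (fun t => ℓ t x) (t : ℝ)) := by
      have : ContinuousOn (deriv (fun t => ℓ t x)) (Metric.ball θ₀ r) := fun t ht =>
        (hx.2 t (hball ht)).continuousAt.continuousWithinAt
      exact continuousOn_iff_continuous_domRestrict.1 this
    exact hd.induction_on (p := fun t : Metric.ball θ₀ r =>
      |deriv (fun t => ℓ t x) (t : ℝ) - a x - b x * ((t : ℝ) - θ₀)|
      ≤ (⨆ n, q x n) * ((t : ℝ) - θ₀) ^ 2) ⟨θ, hθ⟩ (by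
        apply isClosed_le
        · fun_prop
        · fun_prop) (by
        intro n
        by_cases h0 : (d n : ℝ) = θ₀
        · simp [h0, hxa]
        · have : 0 < ((d n : ℝ) - θ₀) ^ 2 := by
            have := sub_ne_zero.2 h0
            positivity
          rw [← div_le_iff₀ this, hxd]
          exact le_ciSup hbdd n)
  refine ⟨hxa.symm, hxb.symm, ciSup_le hq, hG, ?_⟩
  intro h hh
  have hθ : θ₀ + h ∈ Metric.ball θ₀ r := by simpa [Real.dist_eq] using hh
  have hD : ∀ t ∈ Metric.closedBall θ₀ |h|, HasDerivWithinAt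
      (fun t => ℓ t x - a x * (t - θ₀) - b x * (t - θ₀) ^ 2 / 2)
      (deriv (fun t => ℓ t x) t - a x - b x * (t - θ₀)) (Metric.closedBall θ₀ |h|) t := by
    intro t ht
    have ht' : t ∈ Metric.ball θ₀ r := hsub _ hθ (by simpa using ht)
    have h1 := (hx.1 t (hball ht')).hasDerivAt
    have h2 := ((hasDerivAt_id t).sub_const θ₀).const_mul (a x)
    have h3 := ((((hasDerivAt_id t).sub_const θ₀).pow 2).const_mul (b x)).div_const 2
    refine ((h1.sub h2).sub h3).hasDerivWithinAt.congr_deriv ?_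
    simp
    ring
  have := Convex.norm_image_sub_le_of_norm_hasDerivWithin_le hD (C := (⨆ n, q x n) * |h| ^ 2) (by
      intro t ht
      have ht' : t ∈ Metric.ball θ₀ r := hsub _ hθ (by simpa using ht)
      refine (hG t ht').trans ?_
      have : |t - θ₀| ≤ |h| := by simpa [Real.dist_eq] using ht
      have h2 : (t - θ₀) ^ 2 ≤ |h| ^ 2 := by
        rw [← sq_abs]; gcongr
      have : 0 ≤ ⨆ n, q x n := Real.iSup_nonneg fun n => by positivity
      gcongr) (convex_closedBall _ _) (x := θ₀) (y := θ₀ + h) (by simp) (by simp [Real.dist_eq])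
  simp only [sub_self, mul_zero, sub_zero, Real.norm_eq_abs, add_sub_cancel_left] at this
  calc _ = |ℓ (θ₀ + h) x - a x * h - b x * h ^ 2 / 2 - ℓ θ₀ x| := by congr 1; ring
    _ ≤ (⨆ n, q x n) * |h| ^ 2 * |h| := by simpa using this
    _ = _ := by ring

lemma exp_rem (u : ℝ) : |exp u - 1 - u| ≤ u ^ 2 * exp |u| ∧
    |exp u - 1 - u - u ^ 2 / 2| ≤ |u| ^ 3 * exp |u| := by
  have h2 := Complex.norm_exp_sub_sum_le_norm_mul_exp (u : ℂ) 2
  have h3 := Complex.norm_exp_sub_sum_le_norm_mul_exp (u : ℂ) 3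
  simp only [Finset.sum_range_succ, Finset.sum_range_zero] at h2 h3
  norm_num [Nat.factorial] at h2 h3
  constructor
  · have : Complex.exp u - (1 + u) = ((exp u - 1 - u : ℝ) : ℂ) := by push_cast; ring
    rwa [this, Complex.norm_real] at h2
  · have : Complex.exp u - (1 + u + (u : ℂ) ^ 2 / 2) = ((exp u - 1 - u - u ^ 2 / 2 : ℝ) : ℂ) := by
      push_cast; ring
    rwa [this, Complex.norm_real] at h3

lemma integrable_of_exp {𝓧 : Type*} [MeasurableSpace 𝓧] (ν : Measure 𝓧)
    (H : 𝓧 → ℝ) (hHm : AEMeasurable H ν) (hH0 : ∀ x, 0 ≤ H x) (lam : ℝ) (hlam : 0 < lam)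
    (hexp : Integrable (fun x => exp (lam * H x)) ν) : Integrable H ν := by
  refine (hexp.const_mul lam⁻¹).mono' hHm.aestronglyMeasurable (Eventually.of_forall fun x => ?_)
  rw [Real.norm_eq_abs, abs_of_nonneg (hH0 x), inv_mul_eq_div, le_div_iff₀ hlam]
  linarith [add_one_le_exp (lam * H x)]

lemma bartlett {𝓧 : Type*} [MeasurableSpace 𝓧] (ν : Measure 𝓧) [IsProbabilityMeasure ν]
    (a b G H : 𝓧 → ℝ) (ha : Measurable a) (hbi : Integrable b ν) (hGi : Integrable G ν)
    (hHm : Measurable H) (hH0 : ∀ x, 0 ≤ H x) (lam : ℝ) (hlam : 0 < lam)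
    (hexp : Integrable (fun x => exp (lam * H x)) ν)
    (r : ℝ) (hr : 0 < r) (u : ℝ → 𝓧 → ℝ)
    (hum : ∀ h, |h| < r → Measurable (u h))
    (huH : ∀ h, |h| < r → ∀ x, |u h x| ≤ H x * |h|)
    (hu1 : ∀ h, |h| < r → Integrable (fun x => exp (u h x)) ν ∧ ∫ x, exp (u h x) ∂ν = 1)
    (hT : ∀ᵐ x ∂ν, ∀ h, |h| < r → |u h x - a x * h - b x * h ^ 2 / 2| ≤ G x * |h| ^ 3) :
    MemLp a 2 ν ∧ ∫ x, a x ∂ν = 0 ∧ ∫ x, a x ^ 2 ∂ν = - ∫ x, b x ∂ν := by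
  set ρ := min (r / 2) (lam / 2) with hρ
  have hρ0 : 0 < ρ := by positivity
  let h : ℕ → ℝ := fun n => ρ / (n + 1)
  have hh0 : ∀ n, 0 < h n := fun n => by positivity
  have hhρ : ∀ n, h n ≤ ρ := fun n => div_le_self hρ0.le (by simp)
  have hhr : ∀ n, |h n| < r := fun n => by
    rw [abs_of_pos (hh0 n)]
    have := hhρ n
    have : ρ ≤ r / 2 := min_le_left _ _
    linarith
  have hhl : ∀ n, h n ≤ lam / 2 := fun n => (hhρ n).trans (min_le_right _ _)
  have hhlim : Tendsto h atTop (nhds 0) := by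
    have := (tendsto_one_div_add_atTop_nhds_zero_nat (𝕜 := ℝ)).const_mul ρ
    simpa [h, div_eq_mul_inv] using this
  have hHi : Integrable H ν := integrable_of_exp ν H hHm.aemeasurable hH0 lam hlam hexp
  -- pointwise limit of u/h
  have hlim : ∀ᵐ x ∂ν, Tendsto (fun n => u (h n) x / h n) atTop (nhds (a x)) := by
    filter_upwards [hT] with x hx
    rw [tendsto_iff_norm_sub_tendsto_zero]
    refine squeeze_zero (fun _ => norm_nonneg _)
      (g := fun n => |b x| / 2 * h n + G x * h n ^ 2) (fun n => ?_) ?_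
    · have h1 := hx (h n) (hhr n)
      have hp := hh0 n
      rw [abs_of_pos hp] at h1
      have e : u (h n) x / h n - a x = (u (h n) x - a x * h n) / h n := by field_simp
      rw [e, norm_div, Real.norm_eq_abs, Real.norm_eq_abs, abs_of_pos hp, div_le_iff₀ hp]
      have h2 : |b x * h n ^ 2 / 2| = |b x| * h n ^ 2 / 2 := by
        rw [abs_div, abs_mul, abs_of_nonneg (sq_nonneg (h n)), abs_two]
      calc _ = |(u (h n) x - a x * h n - b x * h n ^ 2 / 2) + b x * h n ^ 2 / 2| := by
            congr 1; ring
        _ ≤ _ := abs_add_le _ _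
        _ ≤ G x * h n ^ 3 + |b x| * h n ^ 2 / 2 := by rw [h2]; gcongr
        _ = _ := by ring
    · have := (hhlim.const_mul (|b x| / 2)).add ((hhlim.pow 2).const_mul (G x))
      simpa using this
  have haH : ∀ᵐ x ∂ν, |a x| ≤ H x := by
    filter_upwards [hlim] with x hx
    refine le_of_tendsto hx.abs (Eventually.of_forall fun n => ?_)
    rw [abs_div, div_le_iff₀ (abs_pos.2 (hh0 n).ne')]
    exact huH _ (hhr n) x
  have hdom : ∀ x, ∀ t, t ≤ lam / 2 → H x ^ 2 * exp (H x * t) ≤ 8 / lam ^ 2 * exp (lam * H x) := by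
    intro x t ht
    have hx := hH0 x
    have h1 := quadratic_le_exp_of_nonneg (x := lam / 2 * H x) (by positivity)
    have h2 : exp (H x * t) ≤ exp (lam / 2 * H x) := by
      apply exp_le_exp.2; nlinarith
    have h3 : H x ^ 2 ≤ 8 / lam ^ 2 * exp (lam / 2 * H x) := by
      rw [div_mul_eq_mul_div, le_div_iff₀ (by positivity)]
      have : 0 ≤ lam / 2 * H x := by positivity
      nlinarith
    calc _ ≤ (8 / lam ^ 2 * exp (lam / 2 * H x)) * exp (lam / 2 * H x) := by gcongr
      _ = _ := by rw [mul_assoc, ← exp_add]; congr 2; ring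
  have ha2 : Integrable (fun x => a x ^ 2) ν := by
    refine (hexp.const_mul (8 / lam ^ 2)).mono' (ha.pow_const 2).aestronglyMeasurable ?_
    filter_upwards [haH] with x hx
    have h1 := hdom x 0 (by positivity)
    simp only [mul_zero, exp_zero, mul_one] at h1
    rw [Real.norm_eq_abs, abs_of_nonneg (sq_nonneg _), ← sq_abs]
    refine le_trans ?_ h1
    gcongr
  have hmem : MemLp a 2 ν := (memLp_two_iff_integrable_sq ha.aestronglyMeasurable).2 ha2
  have hai : Integrable a ν := hmem.integrable (by norm_num)
  have hui : ∀ n, Integrable (u (h n)) ν := fun n =>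
    (hHi.mul_const |h n|).mono' (hum _ (hhr n)).aestronglyMeasurable
      (Eventually.of_forall fun x => huH _ (hhr n) x)
  let v : ℕ → 𝓧 → ℝ := fun n x => (exp (u (h n) x) - 1 - u (h n) x) / h n ^ 2
  have hv : Tendsto (fun n => ∫ x, v n x ∂ν) atTop (nhds (∫ x, a x ^ 2 / 2 ∂ν)) := by
    refine tendsto_integral_of_dominated_convergence (fun x => 8 / lam ^ 2 * exp (lam * H x))
      ?_ (hexp.const_mul _) ?_ ?_
    · intro n
      have := hum _ (hhr n)
      exact Measurable.aestronglyMeasurable (by fun_prop)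
    · intro n
      refine Eventually.of_forall fun x => ?_
      have h1 := (exp_rem (u (h n) x)).1
      have h2 := huH _ (hhr n) x
      have hp := hh0 n
      have hx := hH0 x
      rw [abs_of_pos hp] at h2
      refine le_trans ?_ (hdom x (h n) (hhl n))
      simp only [v]
      rw [norm_div, Real.norm_eq_abs, Real.norm_eq_abs, abs_of_nonneg (sq_nonneg (h n)),
        div_le_iff₀ (by positivity)]
      refine h1.trans ?_
      calc u (h n) x ^ 2 * exp |u (h n) x| ≤ (H x * h n) ^ 2 * exp (H x * h n) := by
            rw [← sq_abs]; gcongr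
        _ = _ := by ring
    · filter_upwards [hlim] with x hx
      have h1 : Tendsto (fun n => (u (h n) x / h n) ^ 2 / 2) atTop (nhds (a x ^ 2 / 2)) :=
        (hx.pow 2).div_const 2
      have h2 : Tendsto (fun n => v n x - (u (h n) x / h n) ^ 2 / 2) atTop (nhds 0) := by
        refine squeeze_zero_norm (a := fun n => H x ^ 3 * exp (H x * h n) * h n) (fun n => ?_) ?_
        · have h1 := (exp_rem (u (h n) x)).2
          have h2 := huH _ (hhr n) x
          have hp := hh0 n
          have hxx := hH0 x
          rw [abs_of_pos hp] at h2
          have e : v n x - (u (h n) x / h n) ^ 2 / 2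
              = (exp (u (h n) x) - 1 - u (h n) x - u (h n) x ^ 2 / 2) / h n ^ 2 := by
            simp only [v]; field_simp
          rw [e, norm_div, Real.norm_eq_abs, Real.norm_eq_abs, abs_of_nonneg (sq_nonneg (h n)),
            div_le_iff₀ (by positivity)]
          refine h1.trans ?_
          calc |u (h n) x| ^ 3 * exp |u (h n) x| ≤ (H x * h n) ^ 3 * exp (H x * h n) := by gcongr
            _ = _ := by ring
        · have h3 : Tendsto (fun n => exp (H x * h n)) atTop (nhds (exp (H x * 0))) :=
            (hhlim.const_mul (H x)).rexp
          simpa using (h3.const_mul (H x ^ 3)).mul hhlim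
      have := h2.add h1
      simpa using this
  -- the other evaluation
  have hT' : ∀ n, |h n * ∫ x, v n x ∂ν + ∫ x, a x ∂ν + h n * (∫ x, b x ∂ν) / 2|
      ≤ (∫ x, G x ∂ν) * h n ^ 2 := by
    intro n
    have hp := hh0 n
    have e1 : ∫ x, v n x ∂ν = (- ∫ x, u (h n) x ∂ν) / h n ^ 2 := by
      simp only [v]
      have i1 : Integrable (fun x => exp (u (h n) x) - 1) ν :=
        (hu1 _ (hhr n)).1.sub (integrable_const _)
      rw [integral_div, integral_sub i1 (hui n),
        integral_sub (hu1 _ (hhr n)).1 (integrable_const _), (hu1 _ (hhr n)).2]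
      simp
    have i2 : Integrable (fun x => u (h n) x - a x * h n) ν := (hui n).sub (hai.mul_const _)
    have i3 : Integrable (fun x => b x * h n ^ 2 / 2) ν := (hbi.mul_const _).div_const _
    have e2 : ∫ x, (u (h n) x - a x * h n - b x * h n ^ 2 / 2) ∂ν
        = ∫ x, u (h n) x ∂ν - (∫ x, a x ∂ν) * h n - (∫ x, b x ∂ν) * h n ^ 2 / 2 := by
      rw [integral_sub i2 i3, integral_sub (hui n) (hai.mul_const _), integral_div,
        integral_mul_const, integral_mul_const]
    have e3 : |∫ x, u (h n) x ∂ν - (∫ x, a x ∂ν) * h n - (∫ x, b x ∂ν) * h n ^ 2 / 2|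
        ≤ (∫ x, G x ∂ν) * h n ^ 3 := by
      rw [← e2, ← integral_mul_const, ← Real.norm_eq_abs]
      refine norm_integral_le_of_norm_le (hGi.mul_const _) ?_
      filter_upwards [hT] with x hx
      have := hx (h n) (hhr n)
      rwa [abs_of_pos hp] at this
    have e4 : h n * ∫ x, v n x ∂ν + ∫ x, a x ∂ν + h n * (∫ x, b x ∂ν) / 2
        = - (∫ x, u (h n) x ∂ν - (∫ x, a x ∂ν) * h n - (∫ x, b x ∂ν) * h n ^ 2 / 2) / h n := by
      rw [e1]; field_simp; ring
    rw [e4, abs_div, abs_neg, abs_of_pos hp, div_le_iff₀ hp]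
    calc _ ≤ _ := e3
      _ = _ := by ring
  have hA : ∫ x, a x ∂ν = 0 := by
    have l1 : Tendsto (fun n => h n * ∫ x, v n x ∂ν + ∫ x, a x ∂ν + h n * (∫ x, b x ∂ν) / 2) atTop
        (nhds (0 * (∫ x, a x ^ 2 / 2 ∂ν) + ∫ x, a x ∂ν + 0 * (∫ x, b x ∂ν) / 2)) :=
      ((hhlim.mul hv).add_const _).add ((hhlim.mul_const _).div_const _)
    have l2 : Tendsto (fun n => h n * ∫ x, v n x ∂ν + ∫ x, a x ∂ν + h n * (∫ x, b x ∂ν) / 2) atTop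
        (nhds 0) := squeeze_zero_norm hT' (by simpa using (hhlim.pow 2).const_mul (∫ x, G x ∂ν))
    simpa using tendsto_nhds_unique l1 l2
  refine ⟨hmem, hA, ?_⟩
  have l1 : Tendsto (fun n => ∫ x, v n x ∂ν + (∫ x, b x ∂ν) / 2) atTop
      (nhds ((∫ x, a x ^ 2 / 2 ∂ν) + (∫ x, b x ∂ν) / 2)) := hv.add_const _
  have l2 : Tendsto (fun n => ∫ x, v n x ∂ν + (∫ x, b x ∂ν) / 2) atTop (nhds 0) := by
    refine squeeze_zero_norm (a := fun n => (∫ x, G x ∂ν) * h n) (fun n => ?_)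
      (by simpa using hhlim.const_mul (∫ x, G x ∂ν))
    have h1 := hT' n
    have hp := hh0 n
    rw [hA] at h1
    have e : h n * ∫ x, v n x ∂ν + 0 + h n * (∫ x, b x ∂ν) / 2
      = h n * (∫ x, v n x ∂ν + (∫ x, b x ∂ν) / 2) := by ring
    rw [e, abs_mul, abs_of_pos hp] at h1
    rw [Real.norm_eq_abs]
    refine le_of_mul_le_mul_left (h1.trans_eq ?_) hp
    ring
  have := tendsto_nhds_unique l1 l2
  rw [integral_div] at this
  linarith

lemma slln {𝓧 Ω : Type*} [MeasurableSpace 𝓧] [MeasurableSpace Ω] (P : Measure Ω)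
    [IsProbabilityMeasure P] (ν : Measure 𝓧) (X : ℕ → Ω → 𝓧) (hXm : ∀ i, Measurable (X i))
    (hXi : iIndepFun X P) (hXl : ∀ i, Measure.map (X i) P = ν) (φ : 𝓧 → ℝ) (hφ : Measurable φ)
    (hφi : Integrable φ ν) :
    ∀ᵐ ω ∂P, Tendsto (fun n : ℕ => (∑ i ∈ Finset.range n, φ (X i ω)) / n) atTop
      (nhds (∫ x, φ x ∂ν)) := by
  have hid : ∀ i, IdentDistrib (φ ∘ X i) (φ ∘ X 0) P P := fun i =>
    IdentDistrib.comp ⟨(hXm i).aemeasurable, (hXm 0).aemeasurable, by rw [hXl, hXl]⟩ hφ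
  have hinteg : ∫ x, φ x ∂ν = ∫ ω, (φ ∘ X 0) ω ∂P := by
    rw [← hXl 0, integral_map (hXm 0).aemeasurable hφ.aestronglyMeasurable]
    rfl
  rw [hinteg]
  refine strong_law_ae_real (fun i => φ ∘ X i) ?_ ?_ hid
  · rw [← hXl 0] at hφi
    exact hφi.comp_measurable (hXm 0)
  · intro i j hij
    exact (hXi.comp (fun _ => φ) (fun _ => hφ)).indepFun hij

lemma asymp (I g : ℝ) (hI : 0 < I) (h A B G : ℕ → ℝ) (hh : Tendsto h atTop (nhds 0))
    (hB : Tendsto B atTop (nhds (-I))) (hG : Tendsto G atTop (nhds g))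
    (hb : ∀ᶠ n in atTop, |A n + B n * h n| ≤ G n * h n ^ 2) (Z T V : ℕ → ℝ)
    (hZ : ∀ n : ℕ, Z n = √(I * n) * h n) (hT : ∀ n : ℕ, T n = √n * A n / √I)
    (hV : ∀ n, V n = if T n = 0 then 1 else Z n / T n) :
    Tendsto V atTop (nhds 1) ∧ Tendsto (fun n => Z n - T n * V n) atTop (nhds 0) := by
  classical
  let w : ℕ → ℝ := fun n => if h n = 0 then I else A n / h n
  have hw : Tendsto w atTop (nhds I) := by
    rw [tendsto_iff_norm_sub_tendsto_zero]
    refine squeeze_zero' (Eventually.of_forall fun _ => norm_nonneg _)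
      (g := fun n => |B n - -I| + |G n * h n|) ?_ ?_
    · filter_upwards [hb] with n hn
      by_cases h0 : h n = 0
      · simp only [w, h0, if_true, sub_self, norm_zero]
        positivity
      · simp only [w, h0, if_false, Real.norm_eq_abs]
        have hp : 0 < |h n| := abs_pos.2 h0
        have e1 : |A n / h n + B n| ≤ |G n * h n| := by
          have : A n / h n + B n = (A n + B n * h n) / h n := by field_simp
          rw [this, abs_div, div_le_iff₀ hp]
          refine hn.trans ?_
          rw [← abs_mul]
          refine le_trans (le_of_eq ?_) (le_abs_self _)
          ring
        calc |A n / h n - I| = |(A n / h n + B n) - (B n - -I)| := by congr 1; ring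
          _ ≤ _ := abs_sub _ _
          _ ≤ _ := by linarith
    · have h1 := (hB.sub_const (-I)).abs
      have h2 := (hG.mul hh).abs
      simpa using h1.add h2
  have hw0 : ∀ᶠ n in atTop, w n ≠ 0 := hw.eventually_ne hI.ne'
  have key : ∀ᶠ n in atTop, V n = I / w n ∧ Z n - T n * V n = 0 := by
    filter_upwards [hb, hw0, eventually_gt_atTop 0] with n hn hwn hn0
    have hsI : 0 < √I := sqrt_pos.2 hI
    have hsn : 0 < √(n : ℝ) := sqrt_pos.2 (by exact_mod_cast hn0)
    have hTA : T n = 0 ↔ A n = 0 := by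
      rw [hT]
      simp [hsI.ne', hsn.ne']
    by_cases h0 : h n = 0
    · have hA : A n = 0 := by
        simpa [h0] using hn
      rw [hV, if_pos (hTA.2 hA), hZ, hTA.2 hA, h0]
      simp [w, h0, hI.ne']
    · simp only [w, h0, if_false] at hwn ⊢
      have hA : A n ≠ 0 := fun h => hwn (by simp [h])
      have hTn : T n ≠ 0 := fun h => hA (hTA.1 h)
      rw [hV, if_neg hTn]
      refine ⟨?_, by field_simp; ring⟩
      rw [hZ, hT, sqrt_mul hI.le]
      field_simp
      rw [sq_sqrt hI.le]
  constructor
  · have : Tendsto (fun n => I / w n) atTop (nhds (I / I)) := tendsto_const_nhds.div hw hI.ne'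
    rw [div_self hI.ne'] at this
    exact this.congr' (key.mono fun n hn => hn.1.symm)
  · exact tendsto_const_nhds.congr' (key.mono fun n hn => hn.2.symm)

/-- deterministic consistency argument -/
lemma consist (K : Set ℝ) (hK : IsCompact K) (θ₀ : ℝ) (M : ℕ → ℝ → ℝ) (D : ℝ → ℝ)
    (A : ℕ → ℝ) (A0 : ℝ) (hA : Tendsto A atTop (nhds A0))
    (hlip : ∀ n, ∀ θ ∈ K, ∀ θ' ∈ K, M n θ - M n θ' ≤ A n * |θ - θ'|)
    (hDlip : ∀ θ ∈ K, ∀ θ' ∈ K, D θ - D θ' ≤ A0 * |θ - θ'|)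
    (d : ℕ → K) (hd : DenseRange d)
    (hM : ∀ k, Tendsto (fun n => M n (d k)) atTop (nhds (D (d k))))
    (hD : ∀ θ ∈ K, 0 ≤ D θ → θ = θ₀) (t : ℕ → ℝ) (htK : ∀ n, t n ∈ K)
    (ht : ∀ n, 0 ≤ M n (t n)) : Tendsto t atTop (nhds θ₀) := by
  rw [tendsto_iff_ultrafilter]
  intro U hU
  obtain ⟨θ, hθ, hUθ⟩ := hK.ultrafilter_le_nhds' (U.map t)
    (Filter.mem_map.2 (Eventually.of_forall htK))
  have htθ : Tendsto t U (nhds θ) := hUθ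
  suffices 0 ≤ D θ by rw [← hD θ hθ this]; exact htθ
  have h1 : ∀ k, - (A0 * |θ - d k|) ≤ D (d k) := by
    intro k
    have l1 : Tendsto (fun n => - (A n * |t n - d k|)) U (nhds (- (A0 * |θ - d k|))) :=
      ((hA.mono_left hU).mul (htθ.sub_const _).abs).neg
    refine le_of_tendsto_of_tendsto' l1 ((hM k).mono_left hU) fun n => ?_
    have := hlip n _ (htK n) _ (d k).2
    have := ht n
    linarith
  have h2 : ∀ p : K, 0 ≤ D θ + 2 * A0 * |θ - p| := by
    intro p
    refine hd.induction_on (p := fun p : K => 0 ≤ D θ + 2 * A0 * |θ - p|) p ?_ ?_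
    · exact isClosed_le (by fun_prop) (by fun_prop)
    · intro k
      have e1 := h1 k
      have e2 := hDlip _ (d k).2 _ hθ
      rw [abs_sub_comm] at e2
      linarith
  simpa using h2 ⟨θ, hθ⟩

theorem stmt3
    -- the sample space with a σ-finite base measure
    {𝓧 : Type*} [MeasurableSpace 𝓧] (μ : Measure 𝓧) [SigmaFinite μ]
    -- the parameter set: open, with compact closure K bounded by B
    (Θ : Set ℝ) (hΘopen : IsOpen Θ) (K : Set ℝ) (hK : K = closure Θ)
    (hKcpt : IsCompact K) (B : ℝ) (hB : ∀ θ ∈ K, |θ| ≤ B)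
    -- the statistical model: positive densities, measurable, integrating to one
    (f : ℝ → 𝓧 → ℝ)
    (hf_pos : ∀ θ ∈ K, ∀ x, 0 < f θ x)
    (hf_meas : ∀ θ ∈ K, Measurable (f θ))
    (hf_prob : ∀ θ ∈ K, ∫ x, f θ x ∂μ = 1)
    -- a.e. smoothness: θ ↦ log f(x|θ) is twice differentiable on Θ, continuous on K
    (hf_smooth : ∀ᵐ x ∂μ,
      (∀ θ ∈ Θ, DifferentiableAt ℝ (fun t => Real.log (f t x)) θ) ∧
      (∀ θ ∈ Θ, DifferentiableAt ℝ (deriv (fun t => Real.log (f t x))) θ) ∧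
      ContinuousOn (fun t => Real.log (f t x)) K)
    -- identifiability
    (hident : ∀ θ ∈ K, ∀ θ' ∈ K, f θ =ᵐ[μ] f θ' → θ = θ')
    -- the true parameter
    (θ₀ : ℝ) (hθ₀ : θ₀ ∈ Θ)
    -- the score function
    (s : ℝ → 𝓧 → ℝ) (hs : ∀ θ x, s θ x = deriv (fun t => Real.log (f t x)) θ)
    -- the Fisher information at θ₀: finite and strictly positive
    (IFi : ℝ) (hIFi_int : Integrable (fun x => deriv (fun t => s t x) θ₀ * f θ₀ x) μ)
    (hIFi : IFi = -∫ x, deriv (fun t => s t x) θ₀ * f θ₀ x ∂μ) (hIFi_pos : 0 < IFi)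
    -- the i.i.d. samples X₁, X₂, … with density f(·|θ₀)
    {Ω : Type*} [MeasurableSpace Ω] (P : Measure Ω) [IsProbabilityMeasure P]
    (X : ℕ → Ω → 𝓧) (hX_meas : ∀ i, Measurable (X i))
    (hX_indep : iIndepFun X P)
    (hX_law : ∀ i, Measure.map (X i) P = μ.withDensity (fun x => ENNReal.ofReal (f θ₀ x)))
    -- the maximum likelihood estimator θ̂ₙ, a measurable maximizer of Lₙ over K
    (θhat : ℕ → Ω → ℝ) (hθhat_meas : ∀ n, Measurable (θhat n))
    (hθhat_mem : ∀ (n : ℕ) (ω : Ω), θhat n ω ∈ K)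
    (hθhat_max : ∀ (n : ℕ) (ω : Ω), ∀ θ ∈ K,
      (1 / (n : ℝ)) * ∑ i ∈ Finset.range n, Real.log (f θ (X i ω)) ≤
      (1 / (n : ℝ)) * ∑ i ∈ Finset.range n, Real.log (f (θhat n ω) (X i ω)))
    -- Assumption 1: sub-Gaussian Lipschitz envelope for the log-likelihood
    (H : 𝓧 → ℝ) (hH_nonneg : ∀ x, 0 ≤ H x)
    (hH_lip : ∀ x, ∀ θ ∈ K, ∀ θ' ∈ K,
      |Real.log (f θ x) - Real.log (f θ' x)| ≤ H x * |θ - θ'|)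
    (hH_subG : SubGaussianTail P (fun ω => H (X 0 ω)))
    -- Assumption 2: sub-exponential control of the score derivative
    (Hbar : 𝓧 → ℝ) (hHbar_nonneg : ∀ x, 0 ≤ Hbar x)
    (hHbar_lip : ∀ x, ∀ θ ∈ K,
      |deriv (fun t => s t x) θ₀ - deriv (fun t => s t x) θ| ≤ Hbar x * |θ - θ₀|)
    (hscore_subE : SubExponentialTail P (fun ω => deriv (fun t => s t (X 0 ω)) θ₀))
    (hHbar_subE : SubExponentialTail P (fun ω => Hbar (X 0 ω)))
    -- the normalized estimation error
    (Z : ℕ → Ω → ℝ)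
    (hZ : ∀ (n : ℕ) (ω : Ω), Z n ω = Real.sqrt (IFi * n) * (θhat n ω - θ₀)) :
    -- STATEMENT: Z_n converges in distribution to a standard Gaussian,
    -- i.e. expectations of bounded continuous functions converge
    ∀ g : BoundedContinuousFunction ℝ ℝ,
      Tendsto (fun n => ∫ ω, g (Z n ω) ∂P) atTop
        (nhds (∫ z, g z ∂(gaussianReal 0 1))) := by
  classical
  have hs' : s = fun θ x => deriv (fun t => Real.log (f t x)) θ := by
    funext θ x; exact hs θ x
  subst hs'
  let ℓ : ℝ → 𝓧 → ℝ := fun θ x => Real.log (f θ x)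
  have hΘK : Θ ⊆ K := hK ▸ subset_closure
  have hθK : θ₀ ∈ K := hΘK hθ₀
  set ν : Measure 𝓧 := μ.withDensity (fun x => ENNReal.ofReal (f θ₀ x)) with hν
  have hνP : IsProbabilityMeasure ν := by
    rw [← hX_law 0]; exact Measure.isProbabilityMeasure_map (hX_meas 0).aemeasurable
  have hdm : Measurable (fun x => ENNReal.ofReal (f θ₀ x)) := (hf_meas θ₀ hθK).ennreal_ofReal
  have hνμ : ν ≪ μ := withDensity_absolutelyContinuous _ _
  have hμν : μ ≪ ν := withDensity_absolutelyContinuous' hdm.aemeasurable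
    (Eventually.of_forall fun x => by simpa using hf_pos θ₀ hθK x)
  have hdlt : ∀ᵐ x ∂μ, ENNReal.ofReal (f θ₀ x) < ⊤ :=
    Eventually.of_forall fun x => ENNReal.ofReal_lt_top
  have hνint : ∀ φ : 𝓧 → ℝ, ∫ x, φ x ∂ν = ∫ x, φ x * f θ₀ x ∂μ := by
    intro φ
    rw [hν, integral_withDensity_eq_integral_toReal_smul hdm hdlt]
    congr 1; funext x
    rw [ENNReal.toReal_ofReal (hf_pos θ₀ hθK x).le, smul_eq_mul, mul_comm]
  have hνi : ∀ φ : 𝓧 → ℝ, Integrable φ ν ↔ Integrable (fun x => φ x * f θ₀ x) μ := by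
    intro φ
    rw [hν, integrable_withDensity_iff_integrable_smul' hdm hdlt]
    have : (fun x => (ENNReal.ofReal (f θ₀ x)).toReal • φ x) = fun x => φ x * f θ₀ x := by
      funext x
      rw [ENNReal.toReal_ofReal (hf_pos θ₀ hθK x).le, smul_eq_mul, mul_comm]
    rw [this]
  have hPν : ∀ {p : 𝓧 → Prop}, (∀ᵐ x ∂ν, p x) → ∀ i, ∀ᵐ ω ∂P, p (X i ω) := by
    intro p hp i
    rw [← hX_law i] at hp
    exact ae_of_ae_map (hX_meas i).aemeasurable hp
  have hℓm : ∀ θ ∈ K, Measurable (ℓ θ) := fun θ hθ => (hf_meas θ hθ).log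
  -- likelihood ratio
  have hLR : ∀ θ ∈ K, Integrable (fun x => exp (ℓ θ x - ℓ θ₀ x)) ν ∧
      ∫ x, exp (ℓ θ x - ℓ θ₀ x) ∂ν = 1 := by
    intro θ hθ
    have e : (fun x => exp (ℓ θ x - ℓ θ₀ x) * f θ₀ x) = f θ := by
      funext x
      have h0 := hf_pos θ₀ hθK x
      simp only [ℓ]
      rw [exp_sub, exp_log (hf_pos θ hθ x), exp_log h0]
      field_simp
    rw [hνi, hνint, e]
    refine ⟨?_, hf_prob θ hθ⟩
    by_contra hc
    have := integral_undef hc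
    rw [hf_prob θ hθ] at this
    exact one_ne_zero this
  -- envelopes
  obtain ⟨H', hH'm, hH'0, hH'H, hH'lip⟩ := envelopeA K ⟨θ₀, hθK⟩ ℓ hℓm H hH_nonneg hH_lip
  obtain ⟨r, hr, hball⟩ := Metric.isOpen_iff.1 hΘopen θ₀ hθ₀
  obtain ⟨a, b, G, ham, hbm, hGm, hG0, hae⟩ := envelopeG μ Θ hΘopen ℓ
    (fun θ hθ => hℓm θ (hΘK hθ)) (hf_smooth.mono fun x hx => ⟨hx.1, hx.2.1⟩) θ₀ r hr hball
    Hbar hHbar_nonneg (fun x θ hθ => hHbar_lip x θ (hΘK (hball hθ)))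
  have haeν : Filter.Eventually _ (ae ν) := hνμ.ae_le hae
  -- exponential moments
  have hmapint : ∀ φ : 𝓧 → ℝ, Measurable φ → Integrable (fun ω => φ (X 0 ω)) P →
      Integrable φ ν := by
    intro φ hφ hi
    rw [← hX_law 0]
    exact (integrable_map_measure hφ.aestronglyMeasurable (hX_meas 0).aemeasurable).2 hi
  obtain ⟨lam, hlam, hexpH⟩ := exp_integrable P (fun ω => H (X 0 ω)) (fun ω => H' (X 0 ω))
    (subG_subE _ _ hH_subG) (hH'm.comp (hX_meas 0)).aemeasurable
    (Eventually.of_forall fun ω => hH'0 _)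
    (Eventually.of_forall fun ω => (hH'H _).trans (le_abs_self _))
  have hexpH' : Integrable (fun x => exp (lam * H' x)) ν := hmapint _ (by fun_prop) hexpH
  have hH'i : Integrable H' ν := integrable_of_exp ν H' hH'm.aemeasurable hH'0 lam hlam hexpH'
  obtain ⟨lam2, hlam2, hexpG⟩ := exp_integrable P (fun ω => Hbar (X 0 ω)) (fun ω => G (X 0 ω))
    hHbar_subE (hGm.comp (hX_meas 0)).aemeasurable
    (Eventually.of_forall fun ω => hG0 _)
    (by
      filter_upwards [hPν haeν 0] with ω hω
      exact hω.2.2.1.trans (le_abs_self _))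
  have hGi : Integrable G ν := integrable_of_exp ν G hGm.aemeasurable hG0 lam2 hlam2
    (hmapint _ (by fun_prop) hexpG)
  have hbae : b =ᵐ[ν] fun x => deriv (deriv (fun t => Real.log (f t x))) θ₀ :=
    haeν.mono fun x hx => hx.2.1
  have hbi : Integrable b ν := ((hνi _).2 hIFi_int).congr hbae.symm
  have hbint : ∫ x, b x ∂ν = - IFi := by
    rw [integral_congr_ae hbae, hνint, hIFi, neg_neg]
  -- Bartlett identities
  have hshift : ∀ h, |h| < r → θ₀ + h ∈ K := fun h hh =>
    hΘK (hball (by simpa [Real.dist_eq] using hh))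
  obtain ⟨haL2, ha0, ha2⟩ := bartlett ν a b G H' ham hbi hGi hH'm hH'0 lam hlam hexpH' r hr
    (fun h x => ℓ (θ₀ + h) x - ℓ θ₀ x)
    (fun h hh => (hℓm _ (hshift h hh)).sub (hℓm _ hθK))
    (fun h hh x => by simpa using hH'lip x _ (hshift h hh) _ hθK)
    (fun h hh => hLR _ (hshift h hh))
    (haeν.mono fun x hx => hx.2.2.2.2)
  rw [hbint, neg_neg] at ha2
  -- divergence
  let D : ℝ → ℝ := fun θ => ∫ x, (ℓ θ x - ℓ θ₀ x) ∂ν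
  have hDi : ∀ θ ∈ K, Integrable (fun x => ℓ θ x - ℓ θ₀ x) ν := fun θ hθ =>
    (hH'i.mul_const |θ - θ₀|).mono' ((hℓm _ hθ).sub (hℓm _ hθK)).aestronglyMeasurable
      (Eventually.of_forall fun x => hH'lip x _ hθ _ hθK)
  have hD : ∀ θ ∈ K, 0 ≤ D θ → θ = θ₀ := by
    intro θ hθ h0
    have hg := gibbs ν _ (hDi θ hθ) (hLR θ hθ).1 (hLR θ hθ).2 h0
    apply hident θ hθ θ₀ hθK
    refine hμν.ae_le (hg.mono fun x hx => ?_)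
    have hx' : ℓ θ x = ℓ θ₀ x := sub_eq_zero.1 hx
    exact Real.log_injOn_pos (hf_pos θ hθ x) (hf_pos θ₀ hθK x) hx'
  have hDlip : ∀ θ ∈ K, ∀ θ' ∈ K, D θ - D θ' ≤ (∫ x, H' x ∂ν) * |θ - θ'| := by
    intro θ hθ θ' hθ'
    simp only [D]
    rw [← integral_sub (hDi θ hθ) (hDi θ' hθ'), ← integral_mul_const]
    refine integral_mono ((hDi θ hθ).sub (hDi θ' hθ')) (hH'i.mul_const _) fun x => ?_
    have := (le_abs_self _).trans (hH'lip x θ hθ θ' hθ')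
    simp only
    linarith
  have : Nonempty K := ⟨⟨θ₀, hθK⟩⟩
  let d := TopologicalSpace.denseSeq K
  have hd : DenseRange d := TopologicalSpace.denseRange_denseSeq K
  have SL := slln P ν X hX_meas hX_indep hX_law
  -- consistency
  have hcons : ∀ᵐ ω ∂P, Tendsto (fun n => θhat n ω) atTop (nhds θ₀) := by
    have h1 := SL H' hH'm hH'i
    have h2 : ∀ᵐ ω ∂P, ∀ k, Tendsto (fun n : ℕ => (∑ i ∈ Finset.range n,
        (ℓ (d k) (X i ω) - ℓ θ₀ (X i ω))) / n) atTop (nhds (D (d k))) :=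
      ae_all_iff.2 fun k => SL (fun x => ℓ (d k) x - ℓ θ₀ x)
        ((hℓm _ (d k).2).sub (hℓm _ hθK)) (hDi _ (d k).2)
    filter_upwards [h1, h2] with ω hω1 hω2
    refine consist K hKcpt θ₀
      (fun n θ => (∑ i ∈ Finset.range n, (ℓ θ (X i ω) - ℓ θ₀ (X i ω))) / n) D
      (fun n => (∑ i ∈ Finset.range n, H' (X i ω)) / n) _ hω1 ?_ hDlip d hd hω2 hD _
      (fun n => hθhat_mem n ω) ?_
    · intro n θ hθ θ' hθ'
      rw [← sub_div, ← Finset.sum_sub_distrib, div_mul_eq_mul_div, Finset.sum_mul]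
      gcongr with i hi
      have := (le_abs_self _).trans (hH'lip (X i ω) θ hθ θ' hθ')
      linarith
    · intro n
      have := hθhat_max n ω θ₀ hθK
      simp only [Finset.sum_sub_distrib]
      rw [sub_div]
      simp only [ℓ]
      rw [one_div_mul_eq_div, one_div_mul_eq_div] at this
      linarith
  -- the CLT
  let A : ℕ → Ω → ℝ := fun n ω => (∑ i ∈ Finset.range n, a (X i ω)) / n
  let T : ℕ → Ω → ℝ := fun n ω => √n * A n ω / √IFi
  let V : ℕ → Ω → ℝ := fun n ω => if T n ω = 0 then 1 else Z n ω / T n ω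
  have hAm : ∀ n, Measurable (A n) := fun n => by
    have : ∀ i, Measurable (fun ω => a (X i ω)) := fun i => ham.comp (hX_meas i)
    exact (Finset.measurable_sum _ fun i _ => this i).div_const _
  have hTm : ∀ n, Measurable (T n) := fun n => ((hAm n).const_mul _).div_const _
  have hZm : ∀ n, Measurable (Z n) := fun n => by
    have : Z n = fun ω => √(IFi * n) * (θhat n ω - θ₀) := funext (hZ n)
    rw [this]
    exact ((hθhat_meas n).sub_const _).const_mul _
  have hVm : ∀ n, Measurable (V n) := fun n =>
    Measurable.ite (hTm n (measurableSet_singleton 0)) measurable_const ((hZm n).div (hTm n))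
  have hsI : 0 < √IFi := sqrt_pos.2 hIFi_pos
  have hT : TendstoInDistribution T atTop (id : ℝ → ℝ) (fun _ => P) (gaussianReal 0 1) := by
    have hcm : Measurable (fun x => a x / √IFi) := ham.div_const _
    have h := tendstoInDistribution_inv_sqrt_mul_sum (P := P) (P' := gaussianReal 0 1)
      (Y := (id : ℝ → ℝ)) (X := fun i => (fun x => a x / √IFi) ∘ X i) HasLaw.id ?_ ?_
      (hX_indep.comp (fun _ => fun x => a x / √IFi) (fun _ => hcm))
      (fun i => IdentDistrib.comp
        ⟨(hX_meas i).aemeasurable, (hX_meas 0).aemeasurable, by rw [hX_law, hX_law]⟩ hcm)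
    · have e : T = fun (n : ℕ) ω => (√n)⁻¹ *
          ∑ k ∈ Finset.range n, ((fun x => a x / √IFi) ∘ X k) ω := by
        funext n ω
        simp only [T, A, Function.comp]
        rw [← Finset.sum_div]
        rcases Nat.eq_zero_or_pos n with rfl | hn
        · simp
        · have hsn : 0 < √(n : ℝ) := sqrt_pos.2 (by exact_mod_cast hn)
          have hn2 : (n : ℝ) = √n * √n := (mul_self_sqrt (by positivity)).symm
          have : √(n : ℝ) * ((∑ i ∈ Finset.range n, a (X i ω)) / (√n * √n))
              = (√n)⁻¹ * ∑ i ∈ Finset.range n, a (X i ω) := by field_simp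
          rw [← hn2] at this
          rw [this]; ring
      rw [e]; exact h
    · have : ∫ ω, ((fun x => a x / √IFi) ∘ X 0) ω ∂P = ∫ x, a x / √IFi ∂ν := by
        rw [← hX_law 0, integral_map (hX_meas 0).aemeasurable hcm.aestronglyMeasurable]
        rfl
      rw [this, integral_div, ha0, zero_div]
    · have : ∫ ω, (((fun x => a x / √IFi) ∘ X 0) ^ 2) ω ∂P = ∫ x, (a x / √IFi) ^ 2 ∂ν := by
        rw [← hX_law 0, integral_map (hX_meas 0).aemeasurable (hcm.pow_const 2).aestronglyMeasurable]
        rfl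
      rw [this]
      simp only [div_pow]
      rw [integral_div, ha2, sq_sqrt hIFi_pos.le, div_self hIFi_pos.ne']
  have hlin : ∀ᵐ ω ∂P, Tendsto (fun n => V n ω) atTop (nhds 1) ∧
      Tendsto (fun n => Z n ω - T n ω * V n ω) atTop (nhds 0) := by
    have hall : ∀ᵐ ω ∂P, ∀ i, _ := ae_all_iff.2 fun i => hPν haeν i
    have hsmall : ∀ᵐ ω ∂P, ∀ i, _ := ae_all_iff.2 fun i => hPν (hνμ.ae_le hf_smooth) i
    filter_upwards [hcons, SL b hbm hbi, SL G hGm hGi, hall, hsmall] with ω hc hb hg hx hsm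
    rw [hbint] at hb
    refine asymp IFi _ hIFi_pos (fun n => θhat n ω - θ₀) (fun n => A n ω) _ _ ?_ hb hg ?_
      (fun n => Z n ω) (fun n => T n ω) (fun n => V n ω) (fun n => hZ n ω) (fun n => rfl)
      (fun n => rfl)
    · simpa using hc.sub_const θ₀
    filter_upwards [hc.eventually (Metric.ball_mem_nhds θ₀ hr), eventually_gt_atTop 0]
      with n hn hn0
    have hnpos : (0 : ℝ) < n := by exact_mod_cast hn0
    have hderiv : HasDerivAt (fun θ => ∑ i ∈ Finset.range n, ℓ θ (X i ω))
        (∑ i ∈ Finset.range n, deriv (fun t => ℓ t (X i ω)) (θhat n ω)) (θhat n ω) :=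
      HasDerivAt.fun_sum fun i _ => ((hsm i).1 _ (hball hn)).hasDerivAt
    have hmax : IsLocalMax (fun θ => ∑ i ∈ Finset.range n, ℓ θ (X i ω)) (θhat n ω) := by
      filter_upwards [hΘopen.mem_nhds (hball hn)] with θ hθ
      exact le_of_mul_le_mul_left (hθhat_max n ω θ (hΘK hθ)) (by positivity)
    have hzero := hmax.hasDerivAt_eq_zero hderiv
    have e : A n ω + (∑ i ∈ Finset.range n, b (X i ω)) / n * (θhat n ω - θ₀)
        = -(∑ i ∈ Finset.range n, (deriv (fun t => ℓ t (X i ω)) (θhat n ω) - a (X i ω)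
          - b (X i ω) * (θhat n ω - θ₀))) / n := by
      simp only [A]
      rw [Finset.sum_sub_distrib, Finset.sum_sub_distrib, hzero, ← Finset.sum_mul]
      ring
    rw [e, abs_div, abs_neg, abs_of_pos hnpos, div_mul_eq_mul_div, Finset.sum_mul]
    gcongr
    refine (Finset.abs_sum_le_sum_abs _ _).trans (Finset.sum_le_sum fun i _ => ?_)
    exact (hx i).2.2.2.1 _ hn
  -- Slutsky
  have hTV : TendstoInDistribution (fun n ω => T n ω * V n ω) atTop (id : ℝ → ℝ) (fun _ => P)
      (gaussianReal 0 1) := by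
    have := hT.continuous_comp_prodMk_of_tendstoInMeasure_const
      (g := fun p : ℝ × ℝ => p.1 * p.2) (by fun_prop) (Y := V) (c := 1)
      (tendstoInMeasure_of_tendsto_ae (fun n => (hVm n).aestronglyMeasurable)
        (hlin.mono fun ω h => h.1)) (fun n => (hVm n).aemeasurable)
    simp only [mul_one, id] at this
    exact this
  have hZd : TendstoInDistribution Z atTop (id : ℝ → ℝ) (fun _ => P) (gaussianReal 0 1) := by
    refine tendstoInDistribution_of_tendstoInMeasure_sub Z _ hTV ?_ fun n => (hZm n).aemeasurable
    exact tendstoInMeasure_of_tendsto_ae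
      (fun n => ((hZm n).sub ((hTm n).mul (hVm n))).aestronglyMeasurable)
      (hlin.mono fun ω h => h.2)
  intro g
  have := ProbabilityMeasure.tendsto_iff_forall_integral_tendsto.1 hZd.tendsto g
  simp only [ProbabilityMeasure.coe_mk, Measure.map_id] at this
  refine this.congr fun n => ?_
  exact integral_map (hZm n).aemeasurable g.continuous.aestronglyMeasurable
end

section
/- Under Assumptions 1 and 2, all absolute moments of Z_n converge to those of the standard Gaussian: for every integer m ≥ 1, E[|Z_n|^m] → E[|Z|^m] as n → ∞, where Z ~ N(0,1). -/
open MeasureTheory ProbabilityTheory Filter Real Set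

/-- Exponential integrability of a measurable function. -/
def ExpInt {α : Type*} [MeasurableSpace α] (ν : Measure α) (Y : α → ℝ) : Prop :=
  ∃ a > 0, Integrable (fun x => Real.exp (a * |Y x|)) ν

lemma SubGaussianTail.subExp {Ω : Type*} [MeasurableSpace Ω] {P : Measure Ω}
    [IsProbabilityMeasure P] {W : Ω → ℝ}
    (h : SubGaussianTail P W) : SubExponentialTail P W := by
  obtain ⟨C, hC, c, hc, h⟩ := h
  refine ⟨C * exp c + exp c, by positivity, c, hc, fun t ht => ?_⟩
  by_cases h1 : 1 ≤ t
  · refine (h t ht).trans (ENNReal.ofReal_le_ofReal ?_)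
    have : exp (-c * t ^ 2) ≤ exp c * exp (-c * t) := by
      rw [← exp_add]; apply exp_le_exp.2; nlinarith [mul_pos hc ht, mul_nonneg hc.le (mul_nonneg ht.le (sub_nonneg.2 h1))]
    have h2 : 0 < exp c * exp (-c * t) := by positivity
    nlinarith
  · refine prob_le_one.trans ?_
    rw [← ENNReal.ofReal_one]
    refine ENNReal.ofReal_le_ofReal ?_
    have : 1 ≤ exp c * exp (-c * t) := by
      rw [← exp_add]; apply one_le_exp; nlinarith
    have h2 : 0 < C * (exp c * exp (-c * t)) := by positivity
    nlinarith

lemma SubExponentialTail.expInt {Ω : Type*} [MeasurableSpace Ω] {P : Measure Ω}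
    [IsProbabilityMeasure P] {W : Ω → ℝ} (hW : AEMeasurable W P)
    (h : SubExponentialTail P W) : ExpInt P W := by
  obtain ⟨C, hC, c, hc, h⟩ := h
  refine ⟨c / 2, by positivity, ?_⟩
  have hm : AEMeasurable (fun x => Real.exp (c / 2 * |W x|)) P := by fun_prop
  refine ⟨hm.aestronglyMeasurable, ?_⟩
  rw [hasFiniteIntegral_iff_ofReal (by filter_upwards with x; positivity)]
  -- pointwise bound
  have hpt : ∀ ω, ENNReal.ofReal (Real.exp (c / 2 * |W ω|)) ≤
      ENNReal.ofReal (exp (c / 2)) + ∑' k : ℕ, {ω | (k + 1 : ℝ) ≤ |W ω|}.indicator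
        (fun _ => ENNReal.ofReal (exp (c / 2 * (k + 2)))) ω := by
    intro ω
    rcases hk : ⌊|W ω|⌋₊ with _ | k
    · have : |W ω| < 1 := by
        have := Nat.lt_floor_add_one |W ω|
        rw [hk] at this; simpa using this
      refine le_add_right (ENNReal.ofReal_le_ofReal (exp_le_exp.2 ?_))
      nlinarith
    · have h1 : |W ω| < k + 2 := by
        have := Nat.lt_floor_add_one |W ω|
        rw [hk] at this; push_cast at this; linarith
      have h2 : (k + 1 : ℝ) ≤ |W ω| := by
        have := Nat.floor_le (abs_nonneg (W ω))
        rw [hk] at this; push_cast at this; linarith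
      refine le_add_left (le_trans ?_ (ENNReal.le_tsum k))
      rw [indicator_of_mem (by exact h2)]
      refine (ENNReal.ofReal_le_ofReal (exp_le_exp.2 ?_))
      nlinarith
  have hset : ∀ k : ℕ, NullMeasurableSet {ω | (k + 1 : ℝ) ≤ |W ω|} P := fun k =>
    nullMeasurableSet_le aemeasurable_const (by fun_prop)
  refine (lintegral_mono hpt).trans_lt ?_
  rw [lintegral_add_left measurable_const, lintegral_tsum]
  swap
  · intro k; exact aemeasurable_const.indicator₀ (hset k)
  refine ENNReal.add_lt_top.2 ⟨by simp, ?_⟩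
  have hb : ∀ k : ℕ, ∫⁻ ω, {ω | (k + 1 : ℝ) ≤ |W ω|}.indicator
        (fun _ => ENNReal.ofReal (exp (c / 2 * (k + 2)))) ω ∂P ≤
        ENNReal.ofReal (C * exp (-(c / 2)) ^ k) := by
    intro k
    rw [lintegral_indicator_const₀ (hset k)]
    calc _ ≤ ENNReal.ofReal (exp (c / 2 * (k + 2))) * ENNReal.ofReal (C * Real.exp (-c * (k + 1))) := by
          gcongr; exact h _ (by positivity)
      _ = _ := by
          rw [← ENNReal.ofReal_mul (by positivity)]
          congr 1
          rw [← exp_nat_mul, mul_left_comm, ← exp_add]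
          congr 2; ring
  refine (ENNReal.tsum_le_tsum hb).trans_lt ?_
  rw [← ENNReal.ofReal_tsum_of_nonneg (fun k => by positivity)]
  · simp
  · apply Summable.mul_left
    apply summable_geometric_of_lt_one (by positivity)
    rw [exp_lt_one_iff]; linarith

lemma abs_exp_sub_one_sub_le (x : ℝ) : |exp x - 1 - x| ≤ x ^ 2 * exp |x| := by
  by_cases hx : |x| ≤ 1
  · have := Real.norm_exp_sub_one_sub_id_le (x := x) (by simpa using hx)
    simp only [Real.norm_eq_abs, sq_abs] at this
    refine this.trans ?_
    have := one_le_exp (abs_nonneg x)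
    nlinarith [sq_nonneg x]
  · push Not at hx
    have h1 : 1 ≤ x ^ 2 := by rw [← sq_abs]; nlinarith
    have h2 := add_one_le_exp x
    rw [abs_of_nonneg (by linarith)]
    have h3 : exp |x| ≤ x ^ 2 * exp |x| := le_mul_of_one_le_left (by positivity) h1
    refine le_trans ?_ h3
    rcases le_total 0 x with h | h
    · rw [abs_of_nonneg h]; linarith
    · have h4 := add_one_le_exp |x|
      have h5 : exp x ≤ 1 := exp_le_one_iff.2 h
      rw [abs_of_nonpos h] at h4 ⊢
      linarith

section ExpInt
variable {α : Type*} [MeasurableSpace α] {ν : Measure α} [IsProbabilityMeasure ν] {Y W : α → ℝ}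

lemma pow_le_exp_bound {a : ℝ} (ha : 0 < a) (p : ℕ) (y : ℝ) :
    |y| ^ p ≤ (p.factorial / a ^ p) * exp (a * |y|) := by
  have := Real.pow_div_factorial_le_exp (a * |y|) (by positivity) p
  rw [mul_pow] at this
  have h2 : (0:ℝ) < p.factorial := by positivity
  have h3 : 0 < a ^ p := by positivity
  calc |y| ^ p = (p.factorial / a ^ p) * (a ^ p * |y| ^ p / p.factorial) := by field_simp
    _ ≤ _ := by gcongr

lemma ExpInt.integrable_pow (h : ExpInt ν Y) (hm : AEMeasurable Y ν) (p : ℕ) :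
    Integrable (fun x => |Y x| ^ p) ν := by
  obtain ⟨a, ha, h⟩ := h
  refine (h.const_mul (p.factorial / a ^ p)).mono' ((by fun_prop : AEMeasurable _ ν).aestronglyMeasurable) ?_
  filter_upwards with x
  rw [Real.norm_eq_abs, abs_of_nonneg (by positivity)]
  exact pow_le_exp_bound ha p _

lemma ExpInt.integrable (h : ExpInt ν Y) (hm : AEMeasurable Y ν) : Integrable Y ν := by
  have := h.integrable_pow hm 1
  simp only [pow_one] at this
  exact this.mono' hm.aestronglyMeasurable (by simp)

lemma ExpInt.of_le (h : ExpInt ν W) (hm : AEMeasurable Y ν) {c d : ℝ} (hc : 0 ≤ c)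
    (hle : ∀ᵐ x ∂ν, |Y x| ≤ c * |W x| + d) : ExpInt ν Y := by
  obtain ⟨a, ha, h⟩ := h
  refine ⟨a / (c + 1), by positivity, ?_⟩
  refine (h.const_mul (exp (a / (c + 1) * d))).mono' ((by fun_prop : AEMeasurable _ ν).aestronglyMeasurable) ?_
  filter_upwards [hle] with x hx
  rw [Real.norm_eq_abs, abs_of_nonneg (by positivity), ← exp_add]
  apply exp_le_exp.2
  have h1 : a / (c + 1) * |Y x| ≤ a / (c + 1) * (c * |W x| + d) := by gcongr
  have h2 : a / (c + 1) * (c * |W x|) ≤ a * |W x| := by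
    rw [← mul_assoc]; gcongr
    rw [div_mul_eq_mul_div, div_le_iff₀ (by positivity)]; nlinarith
  linarith

lemma ExpInt.mgf_bound (h : ExpInt ν Y) (hm : AEMeasurable Y ν) (h0 : ∫ x, Y x ∂ν = 0) :
    ∃ a > 0, ∃ L ≥ 0, ∀ t, |t| ≤ a → Integrable (fun x => exp (t * Y x)) ν ∧
      ∫ x, exp (t * Y x) ∂ν ≤ exp (L * t ^ 2) := by
  have hint := h.integrable hm
  obtain ⟨a, ha, h⟩ := h
  set L := (2 / (a / 2) ^ 2) * ∫ x, exp (a * |Y x|) ∂ν with hL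
  have hL0 : 0 ≤ L := by
    have : 0 ≤ ∫ x, exp (a * |Y x|) ∂ν := integral_nonneg fun _ => by positivity
    positivity
  refine ⟨a / 2, by positivity, L, hL0, fun t ht => ?_⟩
  have hti : Integrable (fun x => exp (t * Y x)) ν := by
    refine h.mono' ((by fun_prop : AEMeasurable _ ν).aestronglyMeasurable) ?_
    filter_upwards with x
    rw [Real.norm_eq_abs, abs_of_nonneg (by positivity)]
    apply exp_le_exp.2
    refine (le_abs_self _).trans ?_
    rw [abs_mul]; gcongr; linarith
  refine ⟨hti, ?_⟩
  have hpt : ∀ x, exp (t * Y x) ≤ 1 + t * Y x + t ^ 2 * ((2 / (a / 2) ^ 2) * exp (a * |Y x|)) := by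
    intro x
    have h1 := (le_abs_self _).trans (abs_exp_sub_one_sub_le (t * Y x))
    have h2 := pow_le_exp_bound (half_pos ha) 2 (Y x)
    have h3 : exp |t * Y x| ≤ exp (a / 2 * |Y x|) := by
      apply exp_le_exp.2; rw [abs_mul]; gcongr
    have h4 : (t * Y x) ^ 2 * exp |t * Y x| ≤ t ^ 2 * ((2 / (a / 2) ^ 2) * exp (a * |Y x|)) := by
      have : exp (a * |Y x|) = exp (a / 2 * |Y x|) * exp (a / 2 * |Y x|) := by
        rw [← exp_add]; congr 1; ring
      rw [this, mul_pow, ← sq_abs (Y x), mul_assoc]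
      have h5 : |Y x| ^ 2 ≤ (2 / (a / 2) ^ 2) * exp (a / 2 * |Y x|) := by
        simpa using h2
      have h6 := mul_le_mul h5 h3 (by positivity) (by positivity)
      rw [← mul_assoc (2 / (a / 2) ^ 2)]
      gcongr
    linarith
  calc ∫ x, exp (t * Y x) ∂ν ≤ ∫ x, (1 + t * Y x + t ^ 2 * ((2 / (a / 2) ^ 2) * exp (a * |Y x|))) ∂ν := by
        apply integral_mono hti _ hpt
        exact ((integrable_const _).add (hint.const_mul t)).add ((h.const_mul _).const_mul _)
    _ = 1 + L * t ^ 2 := by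
        have e : Integrable (fun x => 1 + t * Y x) ν := (integrable_const _).add (hint.const_mul t)
        rw [integral_add e ((h.const_mul _).const_mul _),
          integral_add (integrable_const _) (hint.const_mul t), integral_const_mul, integral_const_mul,
          integral_const_mul, h0, ← hL]
        simp [mul_comm]
    _ ≤ _ := by linarith [add_one_le_exp (L * t ^ 2)]

end ExpInt

section Iid
variable {𝓧 : Type*} [MeasurableSpace 𝓧] {ν : Measure 𝓧} [IsProbabilityMeasure ν]
  {Ω : Type*} [MeasurableSpace Ω] {P : Measure Ω} [IsProbabilityMeasure P]
  {X : ℕ → Ω → 𝓧}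

/-- Normalised sum. -/
noncomputable def nsum (X : ℕ → Ω → 𝓧) (Y : 𝓧 → ℝ) (n : ℕ) (ω : Ω) : ℝ :=
  (√(n : ℝ))⁻¹ * ∑ i ∈ Finset.range n, Y (X i ω)

/-- Empirical mean. -/
noncomputable def emean (X : ℕ → Ω → 𝓧) (Y : 𝓧 → ℝ) (n : ℕ) (ω : Ω) : ℝ :=
  (n : ℝ)⁻¹ * ∑ i ∈ Finset.range n, Y (X i ω)

lemma emean_eq (X : ℕ → Ω → 𝓧) (Y : 𝓧 → ℝ) (n : ℕ) (ω : Ω) :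
    nsum X Y n ω = √(n : ℝ) * emean X Y n ω := by
  unfold nsum emean
  rw [← mul_assoc]
  congr 1
  rcases Nat.eq_zero_or_pos n with rfl | h
  · simp
  · have : 0 < (n : ℝ) := by exact_mod_cast h
    have h2 := Real.mul_self_sqrt this.le
    have h3 : 0 < √(n:ℝ) := Real.sqrt_pos.2 this
    field_simp
    nlinarith

lemma nsum_measurable (hX : ∀ i, Measurable (X i)) {Y : 𝓧 → ℝ} (hY : Measurable Y) (n : ℕ) :
    Measurable (nsum X Y n) := by
  unfold nsum
  exact (Finset.measurable_sum _ fun i _ => hY.comp (hX i)).const_mul _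

lemma emean_measurable (hX : ∀ i, Measurable (X i)) {Y : 𝓧 → ℝ} (hY : Measurable Y) (n : ℕ) :
    Measurable (emean X Y n) := by
  unfold emean
  exact (Finset.measurable_sum _ fun i _ => hY.comp (hX i)).const_mul _

lemma nsum_moments (hX : ∀ i, Measurable (X i)) (hind : iIndepFun X P)
    (hlaw : ∀ i, Measure.map (X i) P = ν) {Y : 𝓧 → ℝ} (hY : Measurable Y)
    (hE : ExpInt ν Y) (h0 : ∫ x, Y x ∂ν = 0) (p : ℕ) :
    ∃ C ≥ 0, ∀ n, Integrable (fun ω => |nsum X Y n ω| ^ p) P ∧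
      ∫ ω, |nsum X Y n ω| ^ p ∂P ≤ C := by
  obtain ⟨a, ha, L, hL, hmgf⟩ := hE.mgf_bound hY.aemeasurable h0
  refine ⟨(p.factorial / a ^ p) * (exp (L * a ^ 2) + exp (L * a ^ 2)), by positivity, fun n => ?_⟩
  have hI : iIndepFun (fun i ω => Y (X i ω)) P := hind.comp (fun _ => Y) (fun _ => hY)
  have hm : ∀ i, Measurable (fun ω => Y (X i ω)) := fun i => hY.comp (hX i)
  have key : ∀ b, |b| ≤ a → Integrable (fun ω => exp (b * nsum X Y n ω)) P ∧
      ∫ ω, exp (b * nsum X Y n ω) ∂P ≤ exp (L * a ^ 2) := by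
    intro b hb
    rcases Nat.eq_zero_or_pos n with rfl | hn
    · simp [nsum]; positivity
    set t := b * (√(n:ℝ))⁻¹ with ht
    have hn1 : (1:ℝ) ≤ n := by exact_mod_cast hn
    have hsq : 1 ≤ √(n:ℝ) := Real.one_le_sqrt.2 hn1
    have hta : |t| ≤ a := by
      rw [ht, abs_mul, abs_inv, abs_of_nonneg (Real.sqrt_nonneg _)]
      have : (√(n:ℝ))⁻¹ ≤ 1 := inv_le_one_of_one_le₀ hsq
      nlinarith [abs_nonneg b]
    obtain ⟨h1, h2⟩ := hmgf t hta
    have h1' : ∀ i, Integrable (fun ω => exp (t * Y (X i ω))) P := fun i => by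
      have : Integrable (fun x => exp (t * Y x)) (Measure.map (X i) P) := by rw [hlaw]; exact h1
      exact this.comp_measurable (hX i)
    have h2' : ∀ i, mgf (fun ω => Y (X i ω)) P t ≤ exp (L * t ^ 2) := fun i => by
      have : mgf (fun ω => Y (X i ω)) P t = ∫ x, exp (t * Y x) ∂ν := by
        rw [← hlaw i, integral_map (hX i).aemeasurable]
        · rfl
        · exact (by fun_prop : Measurable fun x => exp (t * Y x)).aestronglyMeasurable
      rw [this]; exact h2
    have heq : ∀ ω, exp (b * nsum X Y n ω) = exp (t * (∑ i ∈ Finset.range n, fun ω => Y (X i ω)) ω) := by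
      intro ω; simp [nsum, ht, mul_assoc]
    simp_rw [heq]
    refine ⟨hI.integrable_exp_mul_sum hm fun i _ => h1' i, ?_⟩
    have := hI.mgf_sum (t := t) hm (Finset.range n)
    unfold mgf at this
    rw [this]
    calc _ ≤ ∏ i ∈ Finset.range n, exp (L * t ^ 2) :=
          Finset.prod_le_prod (fun i _ => mgf_nonneg) fun i _ => h2' i
      _ = exp (L * b ^ 2) := by
          rw [Finset.prod_const, Finset.card_range, ← exp_nat_mul]
          congr 1
          rw [ht, mul_pow, inv_pow, Real.sq_sqrt (by positivity)]
          field_simp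
      _ ≤ _ := by
          apply exp_le_exp.2
          have : b ^ 2 ≤ a ^ 2 := by rw [← sq_abs b]; gcongr
          gcongr
  obtain ⟨k1, k2⟩ := key a (by rw [abs_of_pos ha])
  obtain ⟨k3, k4⟩ := key (-a) (by rw [abs_neg, abs_of_pos ha])
  have hpt : ∀ ω, |nsum X Y n ω| ^ p ≤ (p.factorial / a ^ p) *
      (exp (a * nsum X Y n ω) + exp (-a * nsum X Y n ω)) := by
    intro ω
    refine (pow_le_exp_bound ha p _).trans ?_
    gcongr
    rcases abs_cases (nsum X Y n ω) with ⟨h, _⟩ | ⟨h, _⟩ <;> rw [h]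
    · linarith [exp_pos (-a * nsum X Y n ω)]
    · have : a * -nsum X Y n ω = -a * nsum X Y n ω := by ring
      rw [this]
      linarith [exp_pos (a * nsum X Y n ω)]
  have hi : Integrable (fun ω => |nsum X Y n ω| ^ p) P := by
    refine ((k1.add k3).const_mul (p.factorial / a ^ p)).mono' ?_ ?_
    · exact ((nsum_measurable hX hY n).abs.pow_const p).aestronglyMeasurable
    · filter_upwards with ω
      rw [Real.norm_eq_abs, abs_of_nonneg (by positivity)]
      exact hpt ω
  refine ⟨hi, ?_⟩
  calc _ ≤ ∫ ω, (p.factorial / a ^ p) * (exp (a * nsum X Y n ω) + exp (-a * nsum X Y n ω)) ∂P :=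
        integral_mono hi ((k1.add k3).const_mul (p.factorial / a ^ p)) hpt
    _ ≤ _ := by
        rw [integral_const_mul, integral_add k1 k3]
        gcongr

lemma emean_dev (hX : ∀ i, Measurable (X i)) (hind : iIndepFun X P)
    (hlaw : ∀ i, Measure.map (X i) P = ν) {Y : 𝓧 → ℝ} (hY : Measurable Y)
    (hE : ExpInt ν Y) (h0 : ∫ x, Y x ∂ν = 0) {ε : ℝ} (hε : 0 < ε) (p : ℕ) :
    ∃ C ≥ 0, ∀ n : ℕ, 1 ≤ n → P.real {ω | ε ≤ |emean X Y n ω|} ≤ C / n ^ p := by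
  obtain ⟨C, hC, h⟩ := nsum_moments hX hind hlaw hY hE h0 (2 * p)
  refine ⟨C / ε ^ (2 * p), by positivity, fun n hn => ?_⟩
  obtain ⟨h1, h2⟩ := h n
  have hn0 : (0:ℝ) < n := by exact_mod_cast hn
  have hmk := mul_meas_ge_le_integral_of_nonneg (μ := P) (f := fun ω => |nsum X Y n ω| ^ (2 * p))
    (by filter_upwards with ω; positivity) h1 (ε ^ (2 * p) * n ^ p)
  have hsub : {ω | ε ≤ |emean X Y n ω|} ⊆ {ω | ε ^ (2 * p) * n ^ p ≤ |nsum X Y n ω| ^ (2 * p)} := by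
    intro ω hω
    simp only [mem_ofPred_eq] at hω ⊢
    rw [emean_eq, abs_mul, mul_pow, abs_of_nonneg (Real.sqrt_nonneg _), pow_mul (√(n:ℝ)),
      Real.sq_sqrt hn0.le, mul_comm]
    gcongr
  have := measureReal_mono hsub (μ := P)
  have hp : 0 < ε ^ (2 * p) * (n:ℝ) ^ p := by positivity
  rw [div_div, le_div_iff₀ hp]
  calc _ ≤ P.real {ω | ε ^ (2 * p) * n ^ p ≤ |nsum X Y n ω| ^ (2 * p)} * (ε ^ (2 * p) * n ^ p) := by
        gcongr
    _ ≤ _ := by rw [mul_comm]; exact hmk.trans h2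

/-- Uncentered version. -/
lemma emean_dev' (hX : ∀ i, Measurable (X i)) (hind : iIndepFun X P)
    (hlaw : ∀ i, Measure.map (X i) P = ν) {Y : 𝓧 → ℝ} (hY : Measurable Y)
    (hE : ExpInt ν Y) {ε : ℝ} (hε : 0 < ε) (p : ℕ) :
    ∃ C ≥ 0, ∀ n : ℕ, 1 ≤ n →
      P.real {ω | ε ≤ |emean X Y n ω - ∫ x, Y x ∂ν|} ≤ C / n ^ p := by
  have hi := hE.integrable hY.aemeasurable
  have hE' : ExpInt ν (fun x => Y x - ∫ x, Y x ∂ν) :=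
    hE.of_le (by fun_prop) (c := 1) (d := |∫ x, Y x ∂ν|) zero_le_one
      (by filter_upwards with x; rw [one_mul]; exact abs_sub _ _)
  obtain ⟨C, hC, h⟩ := emean_dev hX hind hlaw (hY.sub_const _) hE' (by
    rw [integral_sub hi (integrable_const _)]; simp) hε p
  refine ⟨C, hC, fun n hn => ?_⟩
  convert h n hn using 6 with ω
  have hn0 : (0:ℝ) < n := by exact_mod_cast hn
  simp [emean, Finset.sum_sub_distrib]
  field_simp

end Iid

lemma trunc_bound {β : Type*} [MeasurableSpace β] (m : ℕ) (ρ : Measure β) [IsProbabilityMeasure ρ]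
    (W : β → ℝ) (hW : AEMeasurable W ρ) (hint : Integrable (fun ω => |W ω| ^ (2 * m)) ρ)
    (M : ℝ) (hM : 0 < M) : |∫ ω, |W ω| ^ m ∂ρ - ∫ ω, min (|W ω| ^ m) M ∂ρ| ≤
      (∫ ω, |W ω| ^ (2 * m) ∂ρ) / M := by
  have hi1 : Integrable (fun ω => |W ω| ^ m) ρ := by
    refine ((integrable_const (1:ℝ)).add hint).mono'
      ((by fun_prop : AEMeasurable _ ρ).aestronglyMeasurable) ?_
    filter_upwards with x
    rw [Real.norm_eq_abs, abs_of_nonneg (by positivity)]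
    simp only [Pi.add_apply, mul_comm 2 m, pow_mul]
    nlinarith [sq_nonneg (|W x| ^ m - 1)]
  have hi2 : Integrable (fun ω => min (|W ω| ^ m) M) ρ := hi1.inf (integrable_const M)
  rw [← integral_sub hi1 hi2, ← integral_div]
  refine (abs_integral_le_integral_abs).trans ?_
  refine integral_mono_of_nonneg (by filter_upwards with x; positivity) (hint.div_const M) ?_
  filter_upwards with x
  simp only [mul_comm 2 m, pow_mul]
  set u := |W x| ^ m
  have hu : 0 ≤ u := by positivity
  rw [le_div_iff₀ hM]
  rcases le_total u M with h | h
  · rw [min_eq_left h]; simp; positivity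
  · rw [min_eq_right h, abs_of_nonneg (by linarith)]
    nlinarith

lemma moments_tendsto {Ω : Type*} [MeasurableSpace Ω] {P : Measure Ω} [IsProbabilityMeasure P]
    {Z : ℕ → Ω → ℝ} {γ : Measure ℝ} [IsProbabilityMeasure γ] (m : ℕ)
    (hγ : Integrable (fun z => |z| ^ (2 * m)) γ)
    (hZ : TendstoInDistribution Z atTop id (fun _ => P) γ) {C : ℝ}
    (hi : ∀ n, Integrable (fun ω => |Z n ω| ^ (2 * m)) P)
    (hC : ∀ n, 1 ≤ n → ∫ ω, |Z n ω| ^ (2 * m) ∂P ≤ C) :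
    Tendsto (fun n => ∫ ω, |Z n ω| ^ m ∂P) atTop (nhds (∫ z, |z| ^ m ∂γ)) := by
  have hZm := hZ.forall_aemeasurable
  rw [Metric.tendsto_atTop]
  intro ε hε
  set C' := ∫ z, |z| ^ (2 * m) ∂γ with hC'
  have hC'0 : 0 ≤ C' := integral_nonneg fun _ => by positivity
  set M := 3 * (|C| + C' + 1) / ε with hM
  have hM0 : 0 < M := by positivity
  have hbd : Tendsto (fun n => ∫ ω, min (|Z n ω| ^ m) M ∂P) atTop (nhds (∫ z, min (|z| ^ m) M ∂γ)) := by
    have ht := hZ.tendsto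
    have ht := ProbabilityMeasure.tendsto_iff_forall_integral_tendsto.1 ht
    have hc : Continuous (fun z : ℝ => min (|z| ^ m) M) := by fun_prop
    let g : BoundedContinuousFunction ℝ ℝ := BoundedContinuousFunction.ofNormedAddCommGroup
      (fun z : ℝ => min (|z| ^ m) M) hc M (fun z => by
        have : 0 ≤ |z| ^ m := by positivity
        rw [Real.norm_eq_abs, abs_of_nonneg (le_min this hM0.le)]
        exact min_le_right _ _)
    have := ht g
    simp only [ProbabilityMeasure.coe_mk] at this
    have e1 : ∀ n, ∫ x, g x ∂(Measure.map (Z n) P) = ∫ ω, min (|Z n ω| ^ m) M ∂P := fun n => by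
      rw [integral_map (hZm n) g.continuous.aestronglyMeasurable]; rfl
    simp_rw [e1] at this
    simpa [g] using this
  obtain ⟨N, hN⟩ := Metric.tendsto_atTop.1 hbd (ε / 3) (by positivity)
  refine ⟨max N 1, fun n hn => ?_⟩
  have a1 := trunc_bound m P (Z n) (hZm n) (hi n) M hM0
  have a2 := trunc_bound m γ (fun z => z) aemeasurable_id hγ M hM0
  have a3 := hN n (le_of_max_le_left hn)
  rw [Real.dist_eq] at a3 ⊢
  have b1 : (∫ ω, |Z n ω| ^ (2 * m) ∂P) / M < ε / 3 := by
    rw [div_lt_iff₀ hM0, hM]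
    have : ε / 3 * (3 * (|C| + C' + 1) / ε) = |C| + C' + 1 := by field_simp
    rw [this]
    linarith [hC n (le_of_max_le_right hn), le_abs_self C]
  have b2 : C' / M < ε / 3 := by
    rw [div_lt_iff₀ hM0, hM]
    have : ε / 3 * (3 * (|C| + C' + 1) / ε) = |C| + C' + 1 := by field_simp
    rw [this]
    linarith [abs_nonneg C]
  rw [abs_lt] at *
  rw [abs_le] at *
  constructor <;> linarith [a1.1, a1.2, a2.1, a2.2, a3.1, a3.2]

section Model
variable {𝓧 : Type*} [MeasurableSpace 𝓧] {ν : Measure 𝓧} [IsProbabilityMeasure ν]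

lemma exists_envelope {ι : Type*} [Countable ι] (g : ι → 𝓧 → ℝ) (hg : ∀ i, AEMeasurable (g i) ν)
    (Hb : 𝓧 → ℝ) (hb : ∀ x, 0 ≤ Hb x) (hle : ∀ᵐ x ∂ν, ∀ i, g i x ≤ Hb x) :
    ∃ G : 𝓧 → ℝ, Measurable G ∧ (∀ x, 0 ≤ G x) ∧
      ∀ᵐ x ∂ν, (∀ i, g i x ≤ G x) ∧ G x ≤ Hb x := by
  have hm : AEMeasurable (fun x => (⨆ i, ENNReal.ofReal (g i x)).toReal) ν :=
    (AEMeasurable.iSup fun i => (hg i).ennreal_ofReal).ennreal_toReal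
  refine ⟨fun x => max (hm.mk _ x) 0, hm.measurable_mk.max measurable_const,
    fun x => le_max_right _ _, ?_⟩
  filter_upwards [hle, hm.ae_eq_mk] with x hx hmk
  rw [← hmk]
  have hsup : (⨆ i, ENNReal.ofReal (g i x)) ≤ ENNReal.ofReal (Hb x) :=
    iSup_le fun i => ENNReal.ofReal_le_ofReal (hx i)
  have hne : (⨆ i, ENNReal.ofReal (g i x)) ≠ ⊤ := ne_top_of_le_ne_top ENNReal.ofReal_ne_top hsup
  rw [max_eq_left ENNReal.toReal_nonneg]
  refine ⟨fun i => ?_, ?_⟩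
  · exact (ENNReal.ofReal_le_iff_le_toReal hne).1 (le_iSup (fun i => ENNReal.ofReal (g i x)) i)
  · exact ENNReal.toReal_le_of_le_ofReal (hb x) hsup

lemma aemeasurable_deriv_of {F : ℝ → 𝓧 → ℝ} {U : Set ℝ} (hU : IsOpen U) {θ : ℝ} (hθ : θ ∈ U)
    (hF : ∀ t ∈ U, AEMeasurable (F t) ν) {F' : 𝓧 → ℝ}
    (hd : ∀ᵐ x ∂ν, HasDerivAt (fun t => F t x) (F' x) θ) : AEMeasurable F' ν := by
  obtain ⟨r, hr, hrU⟩ := Metric.isOpen_iff.1 hU θ hθ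
  have hmem : ∀ n : ℕ, θ + r / (n + 2) ∈ U := fun n => hrU (by
    rw [Metric.mem_ball, Real.dist_eq, add_sub_cancel_left, abs_of_nonneg (by positivity)]
    rw [div_lt_iff₀ (by positivity)]
    nlinarith [(Nat.cast_nonneg n : (0:ℝ) ≤ n)])
  have hlim : Tendsto (fun n : ℕ => r / (n + 2 : ℝ)) atTop (nhds 0) := by
    apply Tendsto.div_atTop tendsto_const_nhds
    exact tendsto_atTop_add_const_right _ _ tendsto_natCast_atTop_atTop
  refine aemeasurable_of_tendsto_metrizable_ae atTop
    (f := fun (n : ℕ) x => (r / (n + 2 : ℝ))⁻¹ * (F (θ + r / (n + 2)) x - F θ x)) (fun n => ?_) ?_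
  · exact ((hF _ (hmem n)).sub (hF θ hθ)).const_mul _
  · filter_upwards [hd] with x hx
    have h := hx.tendsto_slope_zero
    have h2 : Tendsto (fun n : ℕ => r / (n + 2 : ℝ)) atTop (nhdsWithin 0 {0}ᶜ) := by
      refine tendsto_nhdsWithin_iff.2 ⟨hlim, ?_⟩
      filter_upwards with n
      have : r / (n + 2 : ℝ) ≠ 0 := by positivity
      simpa using this
    simpa [Function.comp_def] using h.comp h2

lemma kl_neg {u : 𝓧 → ℝ} (hu : Integrable u ν) (he : Integrable (fun x => exp (u x)) ν)
    (h1 : ∫ x, exp (u x) ∂ν = 1) (hne : ¬ u =ᵐ[ν] 0) : ∫ x, u x ∂ν < 0 := by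
  by_contra! h
  have hw : Integrable (fun x => exp (u x) - (1 + u x)) ν := he.sub ((integrable_const 1).add hu)
  have hw0 : 0 ≤ᵐ[ν] fun x => exp (u x) - (1 + u x) := by
    filter_upwards with x
    have := add_one_le_exp (u x)
    simp only [Pi.zero_apply]; linarith
  have hI : ∫ x, (exp (u x) - (1 + u x)) ∂ν = - ∫ x, u x ∂ν := by
    have e : Integrable (fun x => 1 + u x) ν := (integrable_const 1).add hu
    rw [integral_sub he e, h1, integral_add (integrable_const 1) hu]
    simp
  have hz : ∫ x, (exp (u x) - (1 + u x)) ∂ν = 0 := le_antisymm (by linarith) (integral_nonneg_of_ae hw0)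
  rw [integral_eq_zero_iff_of_nonneg_ae hw0 hw] at hz
  apply hne
  filter_upwards [hz] with x hx
  by_contra hx0
  have := add_one_lt_exp (x := u x) hx0
  simp only [Pi.zero_apply] at hx
  linarith

lemma abs_exp_sub_one_le' (x : ℝ) : |exp x - 1| ≤ |x| * exp |x| := by
  rcases le_total 0 x with h | h
  · rw [abs_of_nonneg h, abs_of_nonneg (by linarith [one_le_exp h])]
    have := add_one_le_exp (-x)
    have h2 : exp x * exp (-x) = 1 := by rw [← exp_add]; simp
    nlinarith [exp_pos x]
  · have h5 : exp x ≤ 1 := exp_le_one_iff.2 h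
    have h1 := add_one_le_exp x
    have h4 := one_le_exp (abs_nonneg x)
    rw [abs_of_nonpos (by linarith)]
    have : |x| = -x := abs_of_nonpos h
    nlinarith [abs_nonneg x]

lemma score_ident {u : ℕ → 𝓧 → ℝ} {δ : ℕ → ℝ} {S D G H0 : 𝓧 → ℝ} {a : ℝ} (ha : 0 < a)
    (hS : AEMeasurable S ν) (hu : ∀ n, AEMeasurable (u n) ν)
    (hH0 : ∀ x, 0 ≤ H0 x) (hG0 : ∀ x, 0 ≤ G x)
    (hHi : Integrable (fun x => exp (a * H0 x)) ν) (hSi : Integrable S ν) (hDi : Integrable D ν)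
    (hGi : Integrable G ν) (hS2 : Integrable (fun x => S x ^ 2) ν)
    (hδ : ∀ n, 0 < δ n) (hδa : ∀ n, δ n ≤ a / 2) (hδ0 : Tendsto δ atTop (nhds 0))
    (hb1 : ∀ᵐ x ∂ν, ∀ n, |u n x| ≤ H0 x * δ n)
    (hb2 : ∀ᵐ x ∂ν, ∀ n, |u n x - S x * δ n - D x * δ n ^ 2 / 2| ≤ G x * δ n ^ 3)
    (h1 : ∀ n, ∫ x, exp (u n x) ∂ν = 1) :
    ∫ x, S x ∂ν = 0 ∧ ∫ x, S x ^ 2 ∂ν = - ∫ x, D x ∂ν := by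
  have hexp : ∀ n, ∀ᵐ x ∂ν, exp |u n x| ≤ exp (a / 2 * |H0 x|) := by
    intro n
    filter_upwards [hb1] with x hx
    apply exp_le_exp.2
    rw [abs_of_nonneg (hH0 x)]
    refine (hx n).trans ?_
    rw [mul_comm]
    exact mul_le_mul_of_nonneg_right (hδa n) (hH0 x)
  have hsplit : ∀ x, exp (a * H0 x) = exp (a / 2 * |H0 x|) * exp (a / 2 * |H0 x|) := fun x => by
    rw [← exp_add, abs_of_nonneg (hH0 x)]; congr 1; ring
  have hei : ∀ n, Integrable (fun x => exp (u n x)) ν := by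
    intro n
    refine hHi.mono' ((hu n).exp.aestronglyMeasurable) ?_
    filter_upwards [hexp n] with x hx
    rw [Real.norm_eq_abs, abs_of_pos (exp_pos _), hsplit]
    have h2 := exp_le_exp.2 (le_abs_self (u n x))
    have h3 : 1 ≤ exp (a / 2 * |H0 x|) := one_le_exp (by positivity)
    nlinarith
  have hslope : ∀ᵐ x ∂ν, Tendsto (fun n => u n x / δ n) atTop (nhds (S x)) := by
    filter_upwards [hb2] with x hx
    have hl : Tendsto (fun n => |D x| * δ n / 2 + G x * δ n ^ 2) atTop (nhds 0) := by
      have := ((hδ0.const_mul |D x|).div_const 2).add ((hδ0.pow 2).const_mul (G x))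
      simpa using this
    rw [tendsto_iff_norm_sub_tendsto_zero]
    refine squeeze_zero (fun _ => norm_nonneg _) (fun n => ?_) hl
    have hd := hδ n
    rw [Real.norm_eq_abs]
    have e : u n x / δ n - S x = ((u n x - S x * δ n - D x * δ n ^ 2 / 2) / δ n) + D x * δ n / 2 := by
      field_simp; ring
    rw [e]
    refine (abs_add_le _ _).trans ?_
    rw [abs_div, abs_of_pos hd, abs_div, abs_mul, abs_of_pos hd, add_comm, abs_two]
    gcongr
    rw [div_le_iff₀ hd]
    refine (hx n).trans (le_of_eq (by ring))
  have hu0 : ∀ᵐ x ∂ν, Tendsto (fun n => u n x) atTop (nhds 0) := by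
    filter_upwards [hb1] with x hx
    rw [tendsto_zero_iff_norm_tendsto_zero]
    refine squeeze_zero (fun _ => norm_nonneg _) hx ?_
    simpa using hδ0.const_mul (H0 x)
  have hsecond : ∀ᵐ x ∂ν, Tendsto (fun n => (exp (u n x) - 1 - u n x) / δ n ^ 2) atTop
      (nhds (S x ^ 2 / 2)) := by
    filter_upwards [hb1, hslope, hu0] with x hx hsl h0
    have hl : Tendsto (fun n => |u n x| * (u n x / δ n) ^ 2 + (u n x / δ n) ^ 2 / 2 - (u n x / δ n) ^ 2 / 2) atTop (nhds 0) := by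
      have := ((h0.abs.mul (hsl.pow 2)).add ((hsl.pow 2).div_const 2)).sub ((hsl.pow 2).div_const 2)
      simpa using this
    have hz : Tendsto (fun n => (exp (u n x) - 1 - u n x) / δ n ^ 2 - (u n x / δ n) ^ 2 / 2) atTop
        (nhds 0) := by
      rw [tendsto_zero_iff_norm_tendsto_zero]
      refine squeeze_zero' (Eventually.of_forall fun _ => norm_nonneg _) ?_ hl
      have hev : ∀ᶠ n in atTop, |u n x| ≤ 1 := by
        have := h0.abs
        rw [abs_zero] at this
        exact this.eventually_le_const one_pos
      filter_upwards [hev] with n hn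
      have hd := hδ n
      have hb := Real.exp_bound hn (n := 3) (by norm_num)
      simp [Finset.sum_range_succ, Nat.factorial] at hb
      rw [Real.norm_eq_abs]
      have e : (exp (u n x) - 1 - u n x) / δ n ^ 2 - (u n x / δ n) ^ 2 / 2
        = (exp (u n x) - (1 + u n x + u n x ^ 2 / 2)) / δ n ^ 2 := by field_simp; ring
      rw [e, abs_div, abs_of_pos (pow_pos hd 2), div_le_iff₀ (pow_pos hd 2)]
      refine hb.trans ?_
      have e2 : (|u n x| * (u n x / δ n) ^ 2 + (u n x / δ n) ^ 2 / 2 - (u n x / δ n) ^ 2 / 2) * δ n ^ 2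
        = |u n x| ^ 3 := by
        rw [pow_succ |u n x| 2, sq_abs]; field_simp; ring
      rw [e2]
      have : 0 ≤ |u n x| ^ 3 := by positivity
      norm_num
      linarith
    have := hz.add ((hsl.pow 2).div_const 2)
    simpa using this
  have hS0 : ∫ x, S x ∂ν = 0 := by
    have hF : ∀ n, ∫ x, (exp (u n x) - 1) / δ n ∂ν = 0 := fun n => by
      rw [integral_div, integral_sub (hei n) (integrable_const _), h1]; simp
    have ht := tendsto_integral_of_dominated_convergence (μ := ν)
      (F := fun n x => (exp (u n x) - 1) / δ n) (f := S)
      (fun x => ((1 : ℕ).factorial / (a / 2) ^ 1) * exp (a * H0 x))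
      (fun n => (((hu n).exp.sub_const 1).div_const _).aestronglyMeasurable)
      (hHi.const_mul _) ?_ ?_
    · simp_rw [hF] at ht
      exact (tendsto_nhds_unique ht tendsto_const_nhds)
    · intro n
      filter_upwards [hb1, hexp n] with x hx hx2
      have hd := hδ n
      rw [Real.norm_eq_abs, abs_div, abs_of_pos hd, div_le_iff₀ hd]
      refine (abs_exp_sub_one_le' _).trans ?_
      have h3 := pow_le_exp_bound (half_pos ha) 1 (H0 x)
      rw [pow_one, abs_of_nonneg (hH0 x)] at h3
      rw [hsplit]
      have h4 := (hx n).trans (mul_le_mul_of_nonneg_right h3 hd.le)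
      refine (mul_le_mul h4 hx2 (exp_pos _).le ((abs_nonneg _).trans h4)).trans (le_of_eq ?_)
      rw [abs_of_nonneg (hH0 x)]; ring
    · filter_upwards [hslope, hsecond] with x hx hx2
      have := hx.add (hx2.mul hδ0)
      rw [mul_zero, add_zero] at this
      refine this.congr fun n => ?_
      have := (hδ n).ne'
      field_simp; ring
  refine ⟨hS0, ?_⟩
  have hF : ∀ n, ∫ x, (exp (u n x) - 1 - S x * δ n) / δ n ^ 2 ∂ν = 0 := fun n => by
    have e : Integrable (fun x => exp (u n x) - 1) ν := (hei n).sub (integrable_const _)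
    rw [integral_div, integral_sub e (hSi.mul_const _),
      integral_sub (hei n) (integrable_const _), h1, integral_mul_const, hS0]; simp
  have ht := tendsto_integral_of_dominated_convergence (μ := ν)
      (F := fun n x => (exp (u n x) - 1 - S x * δ n) / δ n ^ 2) (f := fun x => S x ^ 2 / 2 + D x / 2)
      (fun x => ((2 : ℕ).factorial / (a / 2) ^ 2) * exp (a * H0 x) + (|D x| / 2 + G x * (a / 2)))
      (fun n => ((((hu n).exp.sub_const 1).sub (hS.mul_const _)).div_const _).aestronglyMeasurable)
      ((hHi.const_mul _).add ((hDi.abs.div_const 2).add (hGi.mul_const _))) ?_ ?_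
  · simp_rw [hF] at ht
    have := (tendsto_nhds_unique ht tendsto_const_nhds)
    rw [integral_add (hS2.div_const 2) (hDi.div_const 2), integral_div, integral_div] at this
    linarith
  · intro n
    filter_upwards [hb1, hb2, hexp n] with x hx hx3 hx2
    have hd := hδ n
    rw [Real.norm_eq_abs, abs_div, abs_of_pos (pow_pos hd 2), div_le_iff₀ (pow_pos hd 2)]
    have e : exp (u n x) - 1 - S x * δ n = (exp (u n x) - 1 - u n x) +
      ((u n x - S x * δ n - D x * δ n ^ 2 / 2) + D x * δ n ^ 2 / 2) := by ring
    rw [e]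
    refine (abs_add_le _ _).trans ?_
    have k1 := abs_exp_sub_one_sub_le (u n x)
    have k2 := (abs_add_le (u n x - S x * δ n - D x * δ n ^ 2 / 2) (D x * δ n ^ 2 / 2))
    have h3 := pow_le_exp_bound (half_pos ha) 2 (H0 x)
    rw [sq_abs] at h3
    have k3 : u n x ^ 2 ≤ H0 x ^ 2 * δ n ^ 2 := by
      rw [← sq_abs (u n x), ← mul_pow]; gcongr; exact hx n
    have h4 := k3.trans (mul_le_mul_of_nonneg_right h3 (sq_nonneg _))
    have k4 := (mul_le_mul h4 hx2 (exp_pos _).le ((sq_nonneg _).trans h4))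
    have k5 : |D x * δ n ^ 2 / 2| = |D x| / 2 * δ n ^ 2 := by
      rw [abs_div, abs_mul, abs_of_pos (pow_pos hd 2), abs_two]; ring
    have k6 : G x * δ n ^ 3 ≤ G x * (a / 2) * δ n ^ 2 := by
      have : G x * δ n ^ 3 = G x * δ n * δ n ^ 2 := by ring
      rw [this]; have := hG0 x; have := hδa n
      gcongr
    rw [hsplit]
    have := hx3 n
    rw [k5] at k2
    nlinarith
  · filter_upwards [hsecond, hb2] with x hx hx2
    have hz : Tendsto (fun n => (u n x - S x * δ n - D x * δ n ^ 2 / 2) / δ n ^ 2) atTop (nhds 0) := by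
      rw [tendsto_zero_iff_norm_tendsto_zero]
      refine squeeze_zero (fun _ => norm_nonneg _) (g := fun n => G x * δ n) (fun n => ?_) ?_
      · have hd := hδ n
        rw [Real.norm_eq_abs, abs_div, abs_of_pos (pow_pos hd 2), div_le_iff₀ (pow_pos hd 2)]
        exact (hx2 n).trans (le_of_eq (by ring))
      · simpa using hδ0.const_mul (G x)
    have := hx.add (hz.add_const (D x / 2))
    rw [zero_add] at this
    refine this.congr fun n => ?_
    have := (hδ n).ne'
    field_simp; ring

end Model


section MLE
variable {𝓧 : Type*} [MeasurableSpace 𝓧] {ν : Measure 𝓧} [IsProbabilityMeasure ν]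
  {Ω : Type*} [MeasurableSpace Ω] {P : Measure Ω} [IsProbabilityMeasure P]
  {X : ℕ → Ω → 𝓧}

lemma ae_sample (hX : ∀ i, Measurable (X i)) (hlaw : ∀ i, Measure.map (X i) P = ν)
    {p : 𝓧 → Prop} (h : ∀ᵐ x ∂ν, p x) : ∀ᵐ ω ∂P, ∀ i, p (X i ω) := by
  rw [ae_all_iff]
  intro i
  rw [← hlaw i] at h
  exact ae_of_ae_map (hX i).aemeasurable h

lemma measureReal_le_of_ae {A A' : Set Ω} (h : ∀ᵐ ω ∂P, ω ∈ A → ω ∈ A') :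
    P.real A ≤ P.real A' :=
  ENNReal.toReal_mono (measure_ne_top _ _) (measure_mono_ae h)

lemma mle_consistent (hX : ∀ i, Measurable (X i)) (hind : iIndepFun X P)
    (hlaw : ∀ i, Measure.map (X i) P = ν) {K : Set ℝ} (hK : IsCompact K) {θ₀ : ℝ} (hθ₀ : θ₀ ∈ K)
    {ℓ : ℝ → 𝓧 → ℝ} (hℓ : ∀ θ ∈ K, Measurable (ℓ θ)) {H0 : 𝓧 → ℝ} (hHm : Measurable H0)
    (hH0 : ∀ x, 0 ≤ H0 x) (hHE : ExpInt ν H0)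
    (hlip : ∀ᵐ x ∂ν, ∀ θ ∈ K, ∀ θ' ∈ K, |ℓ θ x - ℓ θ' x| ≤ H0 x * |θ - θ'|)
    (hkl : ∀ θ ∈ K, θ ≠ θ₀ → ∫ x, (ℓ θ x - ℓ θ₀ x) ∂ν < 0)
    {θhat : ℕ → Ω → ℝ} (hmem : ∀ n ω, θhat n ω ∈ K)
    (hmax : ∀ (n : ℕ) (ω : Ω), ∀ θ ∈ K, (1 / (n : ℝ)) * ∑ i ∈ Finset.range n, ℓ θ (X i ω) ≤
      (1 / (n : ℝ)) * ∑ i ∈ Finset.range n, ℓ (θhat n ω) (X i ω))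
    {ε : ℝ} (hε : 0 < ε) (p : ℕ) :
    ∃ C ≥ 0, ∀ n : ℕ, 1 ≤ n → P.real {ω | ε ≤ |θhat n ω - θ₀|} ≤ C / n ^ p := by
  set c : ℝ → ℝ := fun θ => - ∫ x, (ℓ θ x - ℓ θ₀ x) ∂ν with hc
  set M : ℝ := (∫ x, H0 x ∂ν) + 1 with hM
  have hM0 : 0 < M := by have h : 0 ≤ ∫ x, H0 x ∂ν := integral_nonneg hH0; linarith
  have hK' : IsCompact (K \ Metric.ball θ₀ ε) := hK.diff Metric.isOpen_ball
  have hcpos : ∀ θ ∈ K \ Metric.ball θ₀ ε, 0 < c θ := by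
    intro θ hθ
    have : θ ≠ θ₀ := by rintro rfl; exact hθ.2 (Metric.mem_ball_self hε)
    have := hkl θ hθ.1 this
    simp only [hc]; linarith
  obtain ⟨t, htK, htc⟩ := hK'.elim_nhds_subcover (fun θ => Metric.ball θ (c θ / (4 * M)))
    (fun θ hθ => Metric.ball_mem_nhds _ (by have := hcpos θ hθ; positivity))
  have hEθ : ∀ θ ∈ K, ExpInt ν (fun x => ℓ θ x - ℓ θ₀ x) := by
    intro θ hθ
    refine hHE.of_le ((hℓ θ hθ).sub (hℓ θ₀ hθ₀)).aemeasurable (c := |θ - θ₀|) (d := 0) (abs_nonneg _) ?_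
    filter_upwards [hlip] with x hx
    rw [abs_of_nonneg (hH0 x), add_zero, mul_comm]
    exact hx θ hθ θ₀ hθ₀
  have hdev : ∀ θ, ∃ C ≥ 0, θ ∈ t → ∀ n : ℕ, 1 ≤ n →
      P.real {ω | c θ / 4 ≤ |emean X (fun x => ℓ θ x - ℓ θ₀ x) n ω - ∫ x, (ℓ θ x - ℓ θ₀ x) ∂ν|} ≤
        C / n ^ p := by
    intro θ
    by_cases hθ : θ ∈ t
    · have hθK := htK θ hθ
      obtain ⟨C, hC, h⟩ := emean_dev' hX hind hlaw ((hℓ θ hθK.1).sub (hℓ θ₀ hθ₀)) (hEθ θ hθK.1)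
        (ε := c θ / 4) (by have := hcpos θ hθK; positivity) p
      exact ⟨C, hC, fun _ => h⟩
    · exact ⟨0, le_rfl, fun h => absurd h hθ⟩
  choose Cθ hCθ hdevθ using hdev
  obtain ⟨CH, hCH, hdevH⟩ := emean_dev' hX hind hlaw hHm hHE one_pos p
  refine ⟨CH + ∑ θ ∈ t, Cθ θ, add_nonneg hCH (Finset.sum_nonneg fun θ _ => hCθ θ), fun n hn => ?_⟩
  have hn0 : (0:ℝ) < n := by exact_mod_cast hn
  have hsub : P.real {ω | ε ≤ |θhat n ω - θ₀|} ≤ P.real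
      ({ω | 1 ≤ |emean X H0 n ω - ∫ x, H0 x ∂ν|} ∪ ⋃ θ ∈ t,
      {ω | c θ / 4 ≤ |emean X (fun x => ℓ θ x - ℓ θ₀ x) n ω - ∫ x, (ℓ θ x - ℓ θ₀ x) ∂ν|}) := by
    apply measureReal_le_of_ae
    filter_upwards [ae_sample hX hlaw hlip] with ω hω hω1
    by_contra hcon
    simp only [mem_union, mem_iUnion, mem_ofPred_eq, not_or, not_exists, not_le] at hcon hω1
    obtain ⟨hc1, hc2⟩ := hcon
    have hmemK : θhat n ω ∈ K \ Metric.ball θ₀ ε := ⟨hmem n ω, by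
      rw [Metric.mem_ball, Real.dist_eq]; exact not_lt.2 hω1⟩
    obtain ⟨θ, hθt, hθ⟩ := mem_iUnion₂.1 (htc hmemK)
    rw [Metric.mem_ball, Real.dist_eq] at hθ
    have hc2 := hc2 θ hθt
    have hθK := (htK θ hθt).1
    have hcp := hcpos θ (htK θ hθt)
    have hcθ : ∫ x, (ℓ θ x - ℓ θ₀ x) ∂ν = - c θ := by simp [hc]
    rw [hcθ] at hc2
    have e1 := (abs_lt.1 hc2).2
    have e2 := (abs_lt.1 hc1).2
    -- compare
    have e3 := hmax n ω θ₀ hθ₀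
    have e4 : (n:ℝ)⁻¹ * ∑ i ∈ Finset.range n, ℓ (θhat n ω) (X i ω) ≤
        (n:ℝ)⁻¹ * ∑ i ∈ Finset.range n, ℓ θ (X i ω) + emean X H0 n ω * |θhat n ω - θ| := by
      unfold emean
      rw [mul_assoc, ← mul_add, Finset.sum_mul, ← Finset.sum_add_distrib]
      gcongr with i
      have := (abs_le.1 (hω i (θhat n ω) (hmem n ω) θ hθK)).2
      linarith
    have e5 : emean X (fun x => ℓ θ x - ℓ θ₀ x) n ω = (n:ℝ)⁻¹ * ∑ i ∈ Finset.range n, ℓ θ (X i ω)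
        - (n:ℝ)⁻¹ * ∑ i ∈ Finset.range n, ℓ θ₀ (X i ω) := by
      simp [emean, Finset.sum_sub_distrib, mul_sub]
    have e6 : emean X H0 n ω * |θhat n ω - θ| ≤ M * (c θ / (4 * M)) := by
      have : 0 ≤ emean X H0 n ω := by
        unfold emean
        exact mul_nonneg (by positivity) (Finset.sum_nonneg fun i _ => hH0 _)
      have h7 : emean X H0 n ω ≤ M := by linarith
      gcongr
    have e7 : M * (c θ / (4 * M)) = c θ / 4 := by field_simp
    rw [one_div] at e3
    linarith
  refine hsub.trans ((measureReal_union_le _ _).trans ?_)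
  rw [add_div, Finset.sum_div]
  refine add_le_add (hdevH n hn) ((measureReal_biUnion_finset_le _ _).trans ?_)
  exact Finset.sum_le_sum fun θ hθ => hdevθ θ hθ n hn

set_option maxHeartbeats 2000000 in
theorem mle_abstract (hX : ∀ i, Measurable (X i)) (hind : iIndepFun X P)
    (hlaw : ∀ i, Measure.map (X i) P = ν) {K : Set ℝ} (hK : IsCompact K) {B : ℝ}
    (hB : ∀ θ ∈ K, |θ| ≤ B) {θ₀ : ℝ} {ε₀ : ℝ} (hε₀ : 0 < ε₀) (hball : Metric.ball θ₀ ε₀ ⊆ K)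
    {ℓ : ℝ → 𝓧 → ℝ} (hℓ : ∀ θ ∈ K, Measurable (ℓ θ)) {H0 : 𝓧 → ℝ} (hHm : Measurable H0)
    (hH0 : ∀ x, 0 ≤ H0 x) (hHE : ExpInt ν H0)
    (hlip : ∀ᵐ x ∂ν, ∀ θ ∈ K, ∀ θ' ∈ K, |ℓ θ x - ℓ θ' x| ≤ H0 x * |θ - θ'|)
    (hkl : ∀ θ ∈ K, θ ≠ θ₀ → ∫ x, (ℓ θ x - ℓ θ₀ x) ∂ν < 0)
    {S D G : 𝓧 → ℝ} (hSm : Measurable S) (hDm : Measurable D) (hGm : Measurable G)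
    (hG0 : ∀ x, 0 ≤ G x) (hSE : ExpInt ν S) (hDE : ExpInt ν D) (hGE : ExpInt ν G)
    {I : ℝ} (hI : 0 < I) (hS1 : ∫ x, S x ∂ν = 0) (hS2 : ∫ x, S x ^ 2 ∂ν = I)
    (hD1 : ∫ x, D x ∂ν = - I)
    (hexp : ∀ᵐ x ∂ν, ∀ θ ∈ Metric.ball θ₀ ε₀, ∃ s, HasDerivAt (fun t => ℓ t x) s θ ∧
      |s - S x - D x * (θ - θ₀)| ≤ G x * (θ - θ₀) ^ 2)
    {θhat : ℕ → Ω → ℝ} (hθm : ∀ n, Measurable (θhat n)) (hmem : ∀ n ω, θhat n ω ∈ K)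
    (hmax : ∀ (n : ℕ) (ω : Ω), ∀ θ ∈ K, (1 / (n : ℝ)) * ∑ i ∈ Finset.range n, ℓ θ (X i ω) ≤
      (1 / (n : ℝ)) * ∑ i ∈ Finset.range n, ℓ (θhat n ω) (X i ω))
    {Z : ℕ → Ω → ℝ} (hZ : ∀ (n : ℕ) (ω : Ω), Z n ω = √(I * n) * (θhat n ω - θ₀)) (m : ℕ) :
    Tendsto (fun n => ∫ ω, |Z n ω| ^ m ∂P) atTop (nhds (∫ z, |z| ^ m ∂(gaussianReal 0 1))) := by
  have hθ₀ : θ₀ ∈ K := hball (Metric.mem_ball_self hε₀)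
  set EG := ∫ x, G x ∂ν with hEG
  have hEG0 : 0 ≤ EG := integral_nonneg hG0
  obtain ⟨ε, hε, hεε₀, hεI⟩ : ∃ ε > 0, ε ≤ ε₀ ∧ (EG + 1) * ε ≤ I / 4 := by
    refine ⟨min ε₀ (I / 4 / (EG + 1)), lt_min hε₀ (by positivity), min_le_left _ _, ?_⟩
    calc (EG + 1) * min ε₀ (I / 4 / (EG + 1)) ≤ (EG + 1) * (I / 4 / (EG + 1)) := by
          gcongr; exact min_le_right _ _
      _ = I / 4 := by field_simp
  -- the bad event
  set Bad : ℕ → Set Ω := fun n => {ω | ε ≤ |θhat n ω - θ₀|} ∪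
    ({ω | I / 4 ≤ |emean X D n ω - ∫ x, D x ∂ν|} ∪ {ω | 1 ≤ |emean X G n ω - ∫ x, G x ∂ν|}) with hBad
  have hBadm : ∀ n, MeasurableSet (Bad n) := fun n => by
    refine (measurableSet_le measurable_const ((hθm n).sub_const _).abs).union
      ((measurableSet_le measurable_const ((emean_measurable hX hDm n).sub_const _).abs).union
      (measurableSet_le measurable_const ((emean_measurable hX hGm n).sub_const _).abs))
  have hBadP : ∀ p : ℕ, ∃ C ≥ 0, ∀ n : ℕ, 1 ≤ n → P.real (Bad n) ≤ C / n ^ p := by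
    intro p
    obtain ⟨C1, h1, k1⟩ := mle_consistent hX hind hlaw hK hθ₀ hℓ hHm hH0 hHE hlip hkl hmem hmax hε p
    obtain ⟨C2, h2, k2⟩ := emean_dev' hX hind hlaw hDm hDE (ε := I / 4) (by positivity) p
    obtain ⟨C3, h3, k3⟩ := emean_dev' hX hind hlaw hGm hGE one_pos p
    refine ⟨C1 + (C2 + C3), by positivity, fun n hn => ?_⟩
    rw [add_div, add_div]
    exact (measureReal_union_le _ _).trans (add_le_add (k1 n hn)
      ((measureReal_union_le _ _).trans (add_le_add (k2 n hn) (k3 n hn))))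
  -- the score equation off the bad event
  have hscore : ∀ n : ℕ, 1 ≤ n → ∀ᵐ ω ∂P, ω ∉ Bad n →
      |I * (θhat n ω - θ₀) - emean X S n ω| ≤
        |emean X D n ω + I| * |θhat n ω - θ₀| + (EG + 1) * (θhat n ω - θ₀) ^ 2 ∧
      |θhat n ω - θ₀| ≤ 2 / I * |emean X S n ω| := by
    intro n hn
    filter_upwards [ae_sample hX hlaw hexp] with ω hω hbad
    simp only [hBad, mem_union, mem_ofPred_eq, not_or, not_le, hD1, sub_neg_eq_add] at hbad
    obtain ⟨b1, b2, b3⟩ := hbad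
    have hn0 : (0:ℝ) < n := by exact_mod_cast hn
    set δ := θhat n ω - θ₀ with hδ
    have hin : θhat n ω ∈ Metric.ball θ₀ ε₀ := by
      rw [Metric.mem_ball, Real.dist_eq]; exact b1.trans_le hεε₀
    choose sc hsc1 hsc2 using fun i => hω i (θhat n ω) hin
    have hsum : HasDerivAt (fun t => ∑ i ∈ Finset.range n, ℓ t (X i ω))
        (∑ i ∈ Finset.range n, sc i) (θhat n ω) :=
      HasDerivAt.fun_sum fun i _ => hsc1 i
    have hlm : IsLocalMax (fun t => ∑ i ∈ Finset.range n, ℓ t (X i ω)) (θhat n ω) := by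
      filter_upwards [Metric.isOpen_ball.mem_nhds hin] with t ht
      have := hmax n ω t (hball ht)
      exact le_of_mul_le_mul_left this (by positivity)
    have hzero := hlm.hasDerivAt_eq_zero hsum
    have hrem : |emean X S n ω + emean X D n ω * δ| ≤ emean X G n ω * δ ^ 2 := by
      have e : emean X S n ω + emean X D n ω * δ =
          - ((n:ℝ)⁻¹ * ∑ i ∈ Finset.range n, (sc i - S (X i ω) - D (X i ω) * δ)) := by
        simp only [emean, Finset.sum_sub_distrib, hzero, ← Finset.sum_mul]
        ring
      rw [e, abs_neg, abs_mul, abs_of_pos (inv_pos.2 hn0)]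
      unfold emean
      rw [mul_assoc, Finset.sum_mul]
      gcongr
      refine (Finset.abs_sum_le_sum_abs _ _).trans (Finset.sum_le_sum fun i _ => hsc2 i)
    have hG' : emean X G n ω ≤ EG + 1 := by
      have := (abs_lt.1 b3).2; linarith
    have h1 : |I * δ - emean X S n ω| ≤ |emean X D n ω + I| * |δ| + (EG + 1) * δ ^ 2 := by
      have e : I * δ - emean X S n ω = (emean X D n ω + I) * δ -
        (emean X S n ω + emean X D n ω * δ) := by ring
      rw [e]
      refine (abs_sub _ _).trans ?_
      rw [abs_mul]
      gcongr
      refine hrem.trans ?_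
      gcongr
    refine ⟨h1, ?_⟩
    have h2 : (EG + 1) * δ ^ 2 ≤ I / 4 * |δ| := by
      rw [← sq_abs]
      calc (EG + 1) * |δ| ^ 2 = (EG + 1) * |δ| * |δ| := by ring
        _ ≤ (EG + 1) * ε * |δ| := by gcongr
        _ ≤ _ := by gcongr
    have h3 : |emean X D n ω + I| * |δ| ≤ I / 4 * |δ| := by gcongr
    have h4 : I * |δ| ≤ |I * δ - emean X S n ω| + |emean X S n ω| := by
      have := abs_add_le (I * δ - emean X S n ω) (emean X S n ω)
      rw [sub_add_cancel, abs_mul, abs_of_pos hI] at this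
      exact this
    rw [div_mul_eq_mul_div, le_div_iff₀ hI]
    linarith
  have hZm : ∀ n, Measurable (Z n) := fun n => by
    have : Z n = fun ω => √(I * n) * (θhat n ω - θ₀) := funext (hZ n)
    rw [this]; exact ((hθm n).sub_const _).const_mul _
  have hB0 : 0 ≤ B := (abs_nonneg _).trans (hB θ₀ hθ₀)
  have hδB : ∀ n ω, |θhat n ω - θ₀| ≤ 2 * B := fun n ω =>
    (abs_sub _ _).trans (by linarith [hB _ (hmem n ω), hB θ₀ hθ₀])
  have hZpow : ∀ n ω, |Z n ω| ^ (2 * m) = I ^ m * n ^ m * |θhat n ω - θ₀| ^ (2 * m) := by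
    intro n ω
    rw [hZ, abs_mul, mul_pow, abs_of_nonneg (Real.sqrt_nonneg _), pow_mul (√(I * n)),
      Real.sq_sqrt (by positivity), mul_pow]
  have hZi : ∀ n, Integrable (fun ω => |Z n ω| ^ (2 * m)) P := by
    intro n
    refine (integrable_const (I ^ m * n ^ m * (2 * B) ^ (2 * m))).mono'
      (((hZm n).abs.pow_const _).aestronglyMeasurable) ?_
    filter_upwards with ω
    rw [Real.norm_eq_abs, abs_of_nonneg (by positivity), hZpow]
    gcongr
    exact hδB n ω
  -- moment bound
  have hmom : ∃ C, ∀ n, 1 ≤ n → ∫ ω, |Z n ω| ^ (2 * m) ∂P ≤ C := by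
    obtain ⟨C1, hC1, k1⟩ := nsum_moments hX hind hlaw hSm hSE hS1 (2 * m)
    obtain ⟨C2, hC2, k2⟩ := hBadP m
    refine ⟨I ^ m * (2 / I) ^ (2 * m) * C1 + I ^ m * (2 * B) ^ (2 * m) * C2, fun n hn => ?_⟩
    have hn0 : (0:ℝ) < n := by exact_mod_cast hn
    have hpt : ∀ᵐ ω ∂P, |Z n ω| ^ (2 * m) ≤
        I ^ m * (2 / I) ^ (2 * m) * |nsum X S n ω| ^ (2 * m) +
        (Bad n).indicator (fun _ => I ^ m * n ^ m * (2 * B) ^ (2 * m)) ω := by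
      filter_upwards [hscore n hn] with ω hω
      rw [hZpow]
      by_cases hb : ω ∈ Bad n
      · rw [indicator_of_mem hb]
        have : I ^ m * n ^ m * |θhat n ω - θ₀| ^ (2 * m) ≤ I ^ m * n ^ m * (2 * B) ^ (2 * m) := by
          gcongr; exact hδB n ω
        have h2 : 0 ≤ I ^ m * (2 / I) ^ (2 * m) * |nsum X S n ω| ^ (2 * m) := by positivity
        linarith
      · rw [indicator_of_notMem hb, add_zero]
        have h := (hω hb).2
        rw [emean_eq, abs_mul, mul_pow, abs_of_nonneg (Real.sqrt_nonneg _), pow_mul (√(n:ℝ)),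
          Real.sq_sqrt hn0.le]
        calc I ^ m * n ^ m * |θhat n ω - θ₀| ^ (2 * m) ≤
            I ^ m * n ^ m * (2 / I * |emean X S n ω|) ^ (2 * m) := by gcongr
          _ = _ := by rw [mul_pow]; ring
    have hi1 : Integrable (fun ω => I ^ m * (2 / I) ^ (2 * m) * |nsum X S n ω| ^ (2 * m)) P :=
      (k1 n).1.const_mul _
    have hi2 : Integrable (fun ω => (Bad n).indicator
        (fun _ => I ^ m * n ^ m * (2 * B) ^ (2 * m)) ω) P :=
      (integrable_const _).indicator (hBadm n)
    refine (integral_mono_ae (hZi n) (hi1.add hi2) hpt).trans ?_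
    simp only [Pi.add_apply]
    rw [integral_add hi1 hi2, integral_const_mul, integral_indicator_const _ (hBadm n)]
    refine add_le_add ?_ ?_
    · gcongr; exact (k1 n).2
    · have := k2 n hn
      rw [smul_eq_mul]
      calc P.real (Bad n) * (I ^ m * n ^ m * (2 * B) ^ (2 * m)) ≤
          C2 / n ^ m * (I ^ m * n ^ m * (2 * B) ^ (2 * m)) := by gcongr
        _ = _ := by field_simp
  obtain ⟨C, hC⟩ := hmom
  -- convergence in distribution
  set S' : 𝓧 → ℝ := fun x => S x / √I with hS'
  have hsI : 0 < √I := Real.sqrt_pos.2 hI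
  have hS'm : Measurable S' := hSm.div_const _
  have hint : ∀ (g : 𝓧 → ℝ), Measurable g → ∫ ω, g (X 0 ω) ∂P = ∫ x, g x ∂ν := fun g hg => by
    rw [← hlaw 0, integral_map (hX 0).aemeasurable hg.aestronglyMeasurable]
  have hclt : TendstoInDistribution (nsum X S') atTop (id : ℝ → ℝ) (fun _ => P) (gaussianReal 0 1) := by
    refine tendstoInDistribution_inv_sqrt_mul_sum (X := fun i ω => S' (X i ω))
      (HasLaw.id) ?_ ?_ (hind.comp (fun _ => S') (fun _ => hS'm)) (fun i => ?_)
    · rw [hint S' hS'm, hS', integral_div, hS1, zero_div]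
    · have := hint (fun x => S' x ^ 2) (hS'm.pow_const 2)
      simp only [Pi.pow_apply]
      rw [this]
      simp only [hS', div_pow, Real.sq_sqrt hI.le]
      rw [integral_div, hS2, div_self hI.ne']
    · have : IdentDistrib (X i) (X 0) P P :=
        ⟨(hX i).aemeasurable, (hX 0).aemeasurable, by rw [hlaw, hlaw]⟩
      exact this.comp hS'm
  have hS'n : ∀ n ω, nsum X S' n ω = √(n:ℝ) * emean X S n ω / √I := by
    intro n ω
    rw [← emean_eq]
    simp only [nsum, hS', ← Finset.sum_div]; ring
  have hDI : ∫ x, (D x + I) ∂ν = 0 := by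
    rw [integral_add (hDE.integrable hDm.aemeasurable) (integrable_const _), hD1]; simp
  have hDIE : ExpInt ν (fun x => D x + I) :=
    hDE.of_le (by fun_prop) (c := 1) (d := |I|) zero_le_one
      (by filter_upwards with x; rw [one_mul]; exact abs_add_le _ _)
  have hmeas : TendstoInMeasure P (Z - nsum X S') atTop 0 := by
    rw [tendstoInMeasure_iff_measureReal_norm]
    intro η hη
    obtain ⟨C1, hC1, k1⟩ := nsum_moments hX hind hlaw hSm hSE hS1 2
    obtain ⟨C2, hC2, k2⟩ := nsum_moments hX hind hlaw (hDm.add_const I) hDIE hDI 2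
    obtain ⟨C3, hC3, k3⟩ := hBadP 1
    set κ : ℝ := 2 / I + (EG + 1) * (2 / I) ^ 2 with hκ
    have hκ0 : 0 < κ := by positivity
    set V : ℕ → Ω → ℝ := fun n ω => κ / √I *
      (|nsum X (fun x => D x + I) n ω| ^ 2 + |nsum X S n ω| ^ 2) with hV
    have hVi : ∀ n, Integrable (V n) P := fun n => ((k2 n).1.add (k1 n).1).const_mul _
    have hVb : ∀ n, ∫ ω, V n ω ∂P ≤ κ / √I * (C2 + C1) := fun n => by
      simp only [hV]
      rw [integral_const_mul, integral_add (k2 n).1 (k1 n).1]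
      have := (k2 n).2
      have := (k1 n).2
      gcongr
    have hbound : ∀ n : ℕ, 1 ≤ n → P.real {ω | η ≤ ‖(Z - nsum X S') n ω - (0 : Ω → ℝ) ω‖} ≤
        C3 / n + κ / √I * (C2 + C1) / (η * √(n:ℝ)) := by
      intro n hn
      have hn0 : (0:ℝ) < n := by exact_mod_cast hn
      have hsn : 0 < √(n:ℝ) := Real.sqrt_pos.2 hn0
      have hsub : P.real {ω | η ≤ ‖(Z - nsum X S') n ω - (0 : Ω → ℝ) ω‖} ≤
          P.real (Bad n ∪ {ω | η * √(n:ℝ) ≤ V n ω}) := by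
        apply measureReal_le_of_ae
        filter_upwards [hscore n hn] with ω hω hη'
        by_cases hb : ω ∈ Bad n
        · exact Or.inl hb
        · right
          obtain ⟨a1, a2⟩ := hω hb
          simp only [mem_ofPred_eq, Pi.sub_apply, Pi.zero_apply, sub_zero, Real.norm_eq_abs] at hη' ⊢
          rw [hZ, hS'n, Real.sqrt_mul hI.le] at hη'
          set δ := θhat n ω - θ₀
          have e1 : √I * √(n:ℝ) * δ - √(n:ℝ) * emean X S n ω / √I =
              √(n:ℝ) / √I * (I * δ - emean X S n ω) := by
            have : I = √I * √I := (Real.mul_self_sqrt hI.le).symm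
            field_simp
            rw [Real.sq_sqrt hI.le]
            ring
          rw [e1, abs_mul, abs_of_pos (by positivity)] at hη'
          have hDe : emean X (fun x => D x + I) n ω = emean X D n ω + I := by
            simp [emean, Finset.sum_add_distrib]
            field_simp
          have e2 : |I * δ - emean X S n ω| ≤
              κ * (|emean X D n ω + I| ^ 2 + |emean X S n ω| ^ 2) := by
            refine a1.trans ?_
            set q := |emean X D n ω + I|
            set r := |emean X S n ω|
            have hq : 0 ≤ q := abs_nonneg _
            have hr : 0 ≤ r := abs_nonneg _
            have f1 : q * |δ| ≤ 2 / I * (q ^ 2 + r ^ 2) := by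
              calc q * |δ| ≤ q * (2 / I * r) := by gcongr
                _ = 2 / I * (q * r) := by ring
                _ ≤ _ := by gcongr; nlinarith [sq_nonneg (q - r)]
            have f2 : (EG + 1) * δ ^ 2 ≤ (EG + 1) * (2 / I) ^ 2 * (q ^ 2 + r ^ 2) := by
              rw [← sq_abs δ]
              calc (EG + 1) * |δ| ^ 2 ≤ (EG + 1) * (2 / I * r) ^ 2 := by gcongr
                _ = (EG + 1) * (2 / I) ^ 2 * (r ^ 2) := by ring
                _ ≤ _ := by gcongr; nlinarith
            rw [hκ, add_mul]; linarith
          calc η * √(n:ℝ) ≤ √(n:ℝ) / √I * |I * δ - emean X S n ω| * √(n:ℝ) := by gcongr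
            _ ≤ √(n:ℝ) / √I * (κ * (|emean X D n ω + I| ^ 2 + |emean X S n ω| ^ 2)) * √(n:ℝ) := by
                gcongr
            _ = V n ω := by
                simp only [hV, emean_eq, hDe, abs_mul, mul_pow, abs_of_pos hsn, Real.sq_sqrt hn0.le]
                have := Real.mul_self_sqrt hn0.le
                field_simp
                rw [Real.sq_sqrt hn0.le]; ring
      refine hsub.trans ((measureReal_union_le _ _).trans (add_le_add ?_ ?_))
      · simpa using k3 n hn
      · rw [le_div_iff₀ (by positivity), mul_comm]
        refine (mul_meas_ge_le_integral_of_nonneg ?_ (hVi n) _).trans (hVb n)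
        filter_upwards with ω
        simp only [hV, Pi.zero_apply]; positivity
    have hlim : Tendsto (fun n : ℕ => C3 / n + κ / √I * (C2 + C1) / (η * √(n:ℝ))) atTop (nhds 0) := by
      have l1 : Tendsto (fun n : ℕ => C3 / (n:ℝ)) atTop (nhds 0) :=
        tendsto_const_nhds.div_atTop tendsto_natCast_atTop_atTop
      have l2 : Tendsto (fun n : ℕ => κ / √I * (C2 + C1) / (η * √(n:ℝ))) atTop (nhds 0) :=
        tendsto_const_nhds.div_atTop
          ((Real.tendsto_sqrt_atTop.comp tendsto_natCast_atTop_atTop).const_mul_atTop hη)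
      simpa using l1.add l2
    refine squeeze_zero' (Eventually.of_forall fun _ => measureReal_nonneg) ?_ hlim
    filter_upwards [eventually_ge_atTop 1] with n hn using hbound n hn
  have hdist := tendstoInDistribution_of_tendstoInMeasure_sub Z id hclt hmeas
    (fun n => (hZm n).aemeasurable)
  refine moments_tendsto m ?_ hdist hZi hC
  have := (memLp_id_gaussianReal (μ := 0) (v := 1) ((2 * m : ℕ) : NNReal)).integrable_norm_pow'
  simpa using this

end MLE


section Bridge
variable {𝓧 : Type*} [MeasurableSpace 𝓧] {ν : Measure 𝓧} [IsProbabilityMeasure ν]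

lemma expInt_transfer {Ω : Type*} [MeasurableSpace Ω] {P : Measure Ω} [IsProbabilityMeasure P]
    {X0 : Ω → 𝓧} (hX : Measurable X0) (hlaw : Measure.map X0 P = ν) {Y W : 𝓧 → ℝ}
    (hY : Measurable Y) (hle : ∀ᵐ x ∂ν, |Y x| ≤ |W x|)
    (hW : SubExponentialTail P (fun ω => W (X0 ω))) : ExpInt ν Y := by
  have h1 : SubExponentialTail P (fun ω => Y (X0 ω)) := by
    obtain ⟨C, hC, c, hc, h⟩ := hW
    refine ⟨C, hC, c, hc, fun t ht => (measure_mono_ae ?_).trans (h t ht)⟩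
    rw [← hlaw] at hle
    filter_upwards [ae_of_ae_map hX.aemeasurable hle] with ω hω h2
    exact le_trans h2 hω
  obtain ⟨a, ha, h⟩ := h1.expInt (hY.comp hX).aemeasurable
  refine ⟨a, ha, ?_⟩
  rw [← hlaw]
  exact (integrable_map_measure (by fun_prop) hX.aemeasurable).2 h

lemma lip_envelope {K : Set ℝ} {ℓ : ℝ → 𝓧 → ℝ} (hℓ : ∀ θ ∈ K, Measurable (ℓ θ)) {H : 𝓧 → ℝ}
    (hH0 : ∀ x, 0 ≤ H x)
    (hH : ∀ x, ∀ θ ∈ K, ∀ θ' ∈ K, |ℓ θ x - ℓ θ' x| ≤ H x * |θ - θ'|) :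
    ∃ H0 : 𝓧 → ℝ, Measurable H0 ∧ (∀ x, 0 ≤ H0 x) ∧
      ∀ᵐ x ∂ν, (∀ θ ∈ K, ∀ θ' ∈ K, |ℓ θ x - ℓ θ' x| ≤ H0 x * |θ - θ'|) ∧ H0 x ≤ H x := by
  obtain ⟨t, htc, htd⟩ := TopologicalSpace.exists_countable_dense K
  have := htc.to_subtype
  obtain ⟨G, hGm, hG0, hG⟩ := exists_envelope (ν := ν) (ι := t × t)
    (fun p x => |ℓ p.1 x - ℓ p.2 x| / |(p.1 : ℝ) - p.2|)
    (fun p => by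
      have h1 := hℓ p.1 p.1.1.2
      have h2 := hℓ p.2 p.2.1.2
      fun_prop) H hH0
    (Eventually.of_forall fun x p => div_le_of_le_mul₀ (abs_nonneg _) (hH0 x)
      (hH x _ p.1.1.2 _ p.2.1.2))
  refine ⟨G, hGm, hG0, ?_⟩
  filter_upwards [hG] with x hx
  refine ⟨?_, hx.2⟩
  have hcont : Continuous (fun θ : K => ℓ θ x) := by
    refine LipschitzWith.continuous (K := (H x).toNNReal) (LipschitzWith.of_dist_le_mul ?_)
    intro a b
    rw [Real.dist_eq, Subtype.dist_eq, Real.dist_eq, Real.coe_toNNReal _ (hH0 x)]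
    exact hH x a a.2 b b.2
  have hcl : IsClosed {p : K × K | |ℓ p.1 x - ℓ p.2 x| ≤ G x * |(p.1 : ℝ) - p.2|} := by
    refine isClosed_le ?_ (by fun_prop)
    exact ((hcont.comp continuous_fst).sub (hcont.comp continuous_snd)).abs
  have hsub : t ×ˢ t ⊆ {p : K × K | |ℓ p.1 x - ℓ p.2 x| ≤ G x * |(p.1 : ℝ) - p.2|} := by
    rintro ⟨a, b⟩ ⟨ha, hb⟩
    have := hx.1 (⟨a, ha⟩, ⟨b, hb⟩)
    simp only [mem_ofPred_eq] at this ⊢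
    by_cases hab : (a : ℝ) = b
    · simp [hab]
    · exact (div_le_iff₀ (abs_pos.2 (sub_ne_zero.2 hab))).1 this
  intro θ hθ θ' hθ'
  have := (hcl.closure_subset_iff.2 hsub) ((htd.prod htd) (⟨θ, hθ⟩, ⟨θ', hθ'⟩))
  exact this

lemma score_envelope {U : Set ℝ} {θ₀ : ℝ} {sc : ℝ → 𝓧 → ℝ}
    (hsc : ∀ θ ∈ U, AEMeasurable (sc θ) ν) {S D Hb : 𝓧 → ℝ} (hS : Measurable S) (hD : Measurable D)
    (hb : ∀ x, 0 ≤ Hb x)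
    (hle : ∀ᵐ x ∂ν, ∀ θ ∈ U, |sc θ x - S x - D x * (θ - θ₀)| ≤ Hb x * (θ - θ₀) ^ 2)
    (hcont : ∀ᵐ x ∂ν, ContinuousOn (fun t => sc t x) U) :
    ∃ G : 𝓧 → ℝ, Measurable G ∧ (∀ x, 0 ≤ G x) ∧
      ∀ᵐ x ∂ν, (∀ θ ∈ U, |sc θ x - S x - D x * (θ - θ₀)| ≤ G x * (θ - θ₀) ^ 2) ∧ G x ≤ Hb x := by
  obtain ⟨t, htc, htd⟩ := TopologicalSpace.exists_countable_dense U
  have := htc.to_subtype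
  obtain ⟨G, hGm, hG0, hG⟩ := exists_envelope (ν := ν) (ι := t)
    (fun p x => |sc p x - S x - D x * ((p : ℝ) - θ₀)| / ((p : ℝ) - θ₀) ^ 2)
    (fun p => by
      have h1 := hsc p p.1.2
      fun_prop) Hb hb
    (by
      filter_upwards [hle] with x hx p
      exact div_le_of_le_mul₀ (sq_nonneg _) (hb x) (hx _ p.1.2))
  refine ⟨G, hGm, hG0, ?_⟩
  filter_upwards [hG, hle, hcont] with x hx hx2 hc
  refine ⟨?_, hx.2⟩
  have hc' : Continuous (fun θ : U => sc θ x) := continuousOn_iff_continuous_domRestrict.1 hc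
  have hcl : IsClosed {p : U | |sc p x - S x - D x * ((p : ℝ) - θ₀)| ≤ G x * ((p : ℝ) - θ₀) ^ 2} := by
    refine isClosed_le ?_ (by fun_prop)
    exact ((hc'.sub continuous_const).sub (by fun_prop)).abs
  have hsub : t ⊆ {p : U | |sc p x - S x - D x * ((p : ℝ) - θ₀)| ≤ G x * ((p : ℝ) - θ₀) ^ 2} := by
    intro a ha
    have := hx.1 ⟨a, ha⟩
    simp only [mem_ofPred_eq] at this ⊢
    by_cases hab : (a : ℝ) = θ₀
    · have h3 := hx2 a a.2
      rw [hab] at h3 ⊢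
      simpa using h3
    · exact (div_le_iff₀ (by have := sub_ne_zero.2 hab; positivity)).1 this
  intro θ hθ
  exact (hcl.closure_subset_iff.2 hsub) (htd ⟨θ, hθ⟩)

lemma mvt_ball {h h' : ℝ → ℝ} {θ₀ ε₀ M θ : ℝ}
    (hd : ∀ t ∈ Metric.ball θ₀ ε₀, HasDerivAt h (h' t) t) (hθ : θ ∈ Metric.ball θ₀ ε₀)
    (hM : ∀ t ∈ Metric.ball θ₀ ε₀, |t - θ₀| ≤ |θ - θ₀| → |h' t| ≤ M) :
    |h θ - h θ₀| ≤ M * |θ - θ₀| := by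
  rw [Metric.mem_ball, Real.dist_eq] at hθ
  have hin : ∀ t ∈ Metric.closedBall θ₀ |θ - θ₀|, t ∈ Metric.ball θ₀ ε₀ ∧ |t - θ₀| ≤ |θ - θ₀| := by
    intro t ht
    rw [Metric.mem_closedBall, Real.dist_eq] at ht
    rw [Metric.mem_ball, Real.dist_eq]
    exact ⟨ht.trans_lt hθ, ht⟩
  exact (convex_closedBall θ₀ |θ - θ₀|).norm_image_sub_le_of_norm_hasDerivWithin_le
    (fun t ht => (hd t (hin t ht).1).hasDerivWithinAt)
    (fun t ht => hM t (hin t ht).1 (hin t ht).2)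
    (Metric.mem_closedBall_self (abs_nonneg _)) (by rw [Metric.mem_closedBall, Real.dist_eq])

end Bridge

set_option maxHeartbeats 2000000 in
theorem stmt4
    -- the sample space with a σ-finite base measure
    {𝓧 : Type*} [MeasurableSpace 𝓧] (μ : Measure 𝓧) [SigmaFinite μ]
    -- the parameter set: open, with compact closure K bounded by B
    (Θ : Set ℝ) (hΘopen : IsOpen Θ) (K : Set ℝ) (hK : K = closure Θ)
    (hKcpt : IsCompact K) (B : ℝ) (hB : ∀ θ ∈ K, |θ| ≤ B)
    -- the statistical model: positive densities, measurable, integrating to one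
    (f : ℝ → 𝓧 → ℝ)
    (hf_pos : ∀ θ ∈ K, ∀ x, 0 < f θ x)
    (hf_meas : ∀ θ ∈ K, Measurable (f θ))
    (hf_prob : ∀ θ ∈ K, ∫ x, f θ x ∂μ = 1)
    -- a.e. smoothness: θ ↦ log f(x|θ) is twice differentiable on Θ, continuous on K
    (hf_smooth : ∀ᵐ x ∂μ,
      (∀ θ ∈ Θ, DifferentiableAt ℝ (fun t => Real.log (f t x)) θ) ∧
      (∀ θ ∈ Θ, DifferentiableAt ℝ (deriv (fun t => Real.log (f t x))) θ) ∧
      ContinuousOn (fun t => Real.log (f t x)) K)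
    -- identifiability
    (hident : ∀ θ ∈ K, ∀ θ' ∈ K, f θ =ᵐ[μ] f θ' → θ = θ')
    -- the true parameter
    (θ₀ : ℝ) (hθ₀ : θ₀ ∈ Θ)
    -- the score function
    (s : ℝ → 𝓧 → ℝ) (hs : ∀ θ x, s θ x = deriv (fun t => Real.log (f t x)) θ)
    -- the Fisher information at θ₀: finite and strictly positive
    (IFi : ℝ) (hIFi_int : Integrable (fun x => deriv (fun t => s t x) θ₀ * f θ₀ x) μ)
    (hIFi : IFi = -∫ x, deriv (fun t => s t x) θ₀ * f θ₀ x ∂μ) (hIFi_pos : 0 < IFi)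
    -- the i.i.d. samples X₁, X₂, … with density f(·|θ₀)
    {Ω : Type*} [MeasurableSpace Ω] (P : Measure Ω) [IsProbabilityMeasure P]
    (X : ℕ → Ω → 𝓧) (hX_meas : ∀ i, Measurable (X i))
    (hX_indep : iIndepFun X P)
    (hX_law : ∀ i, Measure.map (X i) P = μ.withDensity (fun x => ENNReal.ofReal (f θ₀ x)))
    -- the maximum likelihood estimator θ̂ₙ, a measurable maximizer of Lₙ over K
    (θhat : ℕ → Ω → ℝ) (hθhat_meas : ∀ n, Measurable (θhat n))
    (hθhat_mem : ∀ (n : ℕ) (ω : Ω), θhat n ω ∈ K)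
    (hθhat_max : ∀ (n : ℕ) (ω : Ω), ∀ θ ∈ K,
      (1 / (n : ℝ)) * ∑ i ∈ Finset.range n, Real.log (f θ (X i ω)) ≤
      (1 / (n : ℝ)) * ∑ i ∈ Finset.range n, Real.log (f (θhat n ω) (X i ω)))
    -- Assumption 1: sub-Gaussian Lipschitz envelope for the log-likelihood
    (H : 𝓧 → ℝ) (hH_nonneg : ∀ x, 0 ≤ H x)
    (hH_lip : ∀ x, ∀ θ ∈ K, ∀ θ' ∈ K,
      |Real.log (f θ x) - Real.log (f θ' x)| ≤ H x * |θ - θ'|)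
    (hH_subG : SubGaussianTail P (fun ω => H (X 0 ω)))
    -- Assumption 2: sub-exponential control of the score derivative
    (Hbar : 𝓧 → ℝ) (hHbar_nonneg : ∀ x, 0 ≤ Hbar x)
    (hHbar_lip : ∀ x, ∀ θ ∈ K,
      |deriv (fun t => s t x) θ₀ - deriv (fun t => s t x) θ| ≤ Hbar x * |θ - θ₀|)
    (hscore_subE : SubExponentialTail P (fun ω => deriv (fun t => s t (X 0 ω)) θ₀))
    (hHbar_subE : SubExponentialTail P (fun ω => Hbar (X 0 ω)))
    -- the normalized estimation error
    (Z : ℕ → Ω → ℝ)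
    (hZ : ∀ (n : ℕ) (ω : Ω), Z n ω = Real.sqrt (IFi * n) * (θhat n ω - θ₀)) :
    -- STATEMENT: convergence of all absolute moments to the Gaussian moments
    ∀ m : ℕ, 1 ≤ m →
      Tendsto (fun n => ∫ ω, |Z n ω| ^ m ∂P) atTop
        (nhds (∫ z, |z| ^ m ∂(gaussianReal 0 1))) := by
  intro m _
  set ν : Measure 𝓧 := μ.withDensity (fun x => ENNReal.ofReal (f θ₀ x)) with hν
  have hΘK : Θ ⊆ K := hK ▸ subset_closure
  have hθ₀K := hΘK hθ₀
  have : IsProbabilityMeasure ν := by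
    rw [← hX_law 0]; exact Measure.isProbabilityMeasure_map (hX_meas 0).aemeasurable
  have hνμ : ν ≪ μ := withDensity_absolutelyContinuous _ _
  have hμν : ∀ {p : 𝓧 → Prop}, (∀ᵐ x ∂ν, p x) → ∀ᵐ x ∂μ, p x := by
    intro p hp
    rw [hν, ae_withDensity_iff (hf_meas θ₀ hθ₀K).ennreal_ofReal] at hp
    filter_upwards [hp] with x hx
    exact hx (by simpa using hf_pos θ₀ hθ₀K x)
  have hwint : ∀ g : 𝓧 → ℝ, ∫ x, g x ∂ν = ∫ x, f θ₀ x * g x ∂μ := by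
    intro g
    rw [hν, integral_withDensity_eq_integral_toReal_smul (hf_meas θ₀ hθ₀K).ennreal_ofReal
      (Eventually.of_forall fun x => ENNReal.ofReal_lt_top)]
    refine integral_congr_ae (Eventually.of_forall fun x => ?_)
    simp [ENNReal.toReal_ofReal (hf_pos θ₀ hθ₀K x).le]
  set ℓ : ℝ → 𝓧 → ℝ := fun θ x => Real.log (f θ x) with hℓdef
  have hℓ : ∀ θ ∈ K, Measurable (ℓ θ) := fun θ hθ => (hf_meas θ hθ).log
  have hsf : ∀ x, (fun t => s t x) = deriv (fun t => ℓ t x) := fun x => funext fun t => hs t x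
  have hsm : ∀ᵐ x ∂ν, (∀ θ ∈ Θ, HasDerivAt (fun t => ℓ t x) (s θ x) θ) ∧
      (∀ θ ∈ Θ, HasDerivAt (fun t => s t x) (deriv (fun t => s t x) θ) θ) := by
    filter_upwards [hνμ.ae_le hf_smooth] with x hx
    refine ⟨fun θ hθ => ?_, fun θ hθ => ?_⟩
    · rw [hs]; exact (hx.1 θ hθ).hasDerivAt
    · rw [hsf]; exact (hx.2.1 θ hθ).hasDerivAt
  -- Lipschitz envelope
  obtain ⟨H0, hHm, hH0, hHH⟩ := lip_envelope (ν := ν) hℓ hH_nonneg hH_lip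
  have hlip : ∀ᵐ x ∂ν, ∀ θ ∈ K, ∀ θ' ∈ K, |ℓ θ x - ℓ θ' x| ≤ H0 x * |θ - θ'| :=
    hHH.mono fun x hx => hx.1
  have hHE : ExpInt ν H0 := by
    refine expInt_transfer (hX_meas 0) (hX_law 0) hHm ?_ hH_subG.subExp
    filter_upwards [hHH] with x hx
    rw [abs_of_nonneg (hH0 x), abs_of_nonneg (hH_nonneg x)]; exact hx.2
  -- score and derivative
  have hsmeas : ∀ θ ∈ Θ, AEMeasurable (s θ) ν := fun θ hθ =>
    aemeasurable_deriv_of hΘopen hθ (fun t ht => (hℓ t (hΘK ht)).aemeasurable)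
      (hsm.mono fun x hx => hx.1 θ hθ)
  have hs'meas : AEMeasurable (fun x => deriv (fun t => s t x) θ₀) ν :=
    aemeasurable_deriv_of hΘopen hθ₀ hsmeas (hsm.mono fun x hx => hx.2 θ₀ hθ₀)
  set S : 𝓧 → ℝ := (hsmeas θ₀ hθ₀).mk with hS
  set D : 𝓧 → ℝ := hs'meas.mk with hD
  have hSm : Measurable S := (hsmeas θ₀ hθ₀).measurable_mk
  have hDm : Measurable D := hs'meas.measurable_mk
  have hSe : ∀ᵐ x ∂ν, s θ₀ x = S x := (hsmeas θ₀ hθ₀).ae_eq_mk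
  have hDe : ∀ᵐ x ∂ν, deriv (fun t => s t x) θ₀ = D x := hs'meas.ae_eq_mk
  have hDE : ExpInt ν D := by
    refine expInt_transfer (W := fun x => deriv (fun t => s t x) θ₀) (hX_meas 0) (hX_law 0) hDm ?_ hscore_subE
    filter_upwards [hDe] with x hx
    rw [hx]
  have hSH : ∀ᵐ x ∂ν, |S x| ≤ H0 x := by
    filter_upwards [hSe, hsm, hlip] with x h1 h2 h3
    rw [← h1]
    have h4 := (h2.1 θ₀ hθ₀).le_of_lip' (hH0 x) (C := H0 x) (by
      filter_upwards [hΘopen.mem_nhds hθ₀] with t ht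
      exact h3 t (hΘK ht) θ₀ hθ₀K)
    simpa using h4
  have hSE : ExpInt ν S := by
    refine hHE.of_le hSm.aemeasurable (c := 1) (d := 0) zero_le_one ?_
    filter_upwards [hSH] with x hx
    rw [abs_of_nonneg (hH0 x)]; linarith
  obtain ⟨ε₀, hε₀, hball⟩ := Metric.isOpen_iff.1 hΘopen θ₀ hθ₀
  have hrem : ∀ᵐ x ∂ν, ∀ θ ∈ Metric.ball θ₀ ε₀,
      |s θ x - S x - D x * (θ - θ₀)| ≤ Hbar x * (θ - θ₀) ^ 2 := by
    filter_upwards [hSe, hDe, hsm] with x h1 h2 h3 θ hθ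
    have h4 := mvt_ball (h := fun t => s t x - D x * (t - θ₀))
      (h' := fun t => deriv (fun t => s t x) t - D x) (M := Hbar x * |θ - θ₀|)
      (fun t ht => by
        have e2 := (h3.2 t (hball ht)).fun_sub (((hasDerivAt_id' t).sub_const θ₀).const_mul (D x))
        rwa [mul_one] at e2) hθ
      (fun t ht ht2 => by
        rw [← h2, abs_sub_comm]
        refine (hHbar_lip x t (hΘK (hball ht))).trans ?_
        have := hHbar_nonneg x
        gcongr)
    rw [mul_assoc, abs_mul_abs_self, ← sq, sub_self, mul_zero, sub_zero, h1] at h4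
    rwa [show s θ x - S x - D x * (θ - θ₀) = s θ x - D x * (θ - θ₀) - S x by ring]
  obtain ⟨G, hGm, hG0, hGG⟩ := score_envelope (ν := ν) (U := Metric.ball θ₀ ε₀) (θ₀ := θ₀) (sc := s)
    (fun θ hθ => hsmeas θ (hball hθ)) hSm hDm hHbar_nonneg hrem
    (hsm.mono fun x hx t ht => (hx.2 t (hball ht)).continuousAt.continuousWithinAt)
  have hGE : ExpInt ν G := by
    refine expInt_transfer (hX_meas 0) (hX_law 0) hGm ?_ hHbar_subE
    filter_upwards [hGG] with x hx
    rw [abs_of_nonneg (hG0 x), abs_of_nonneg (hHbar_nonneg x)]; exact hx.2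
  have hexp : ∀ᵐ x ∂ν, ∀ θ ∈ Metric.ball θ₀ ε₀, ∃ s, HasDerivAt (fun t => ℓ t x) s θ ∧
      |s - S x - D x * (θ - θ₀)| ≤ G x * (θ - θ₀) ^ 2 := by
    filter_upwards [hGG, hsm] with x h1 h2 θ hθ
    exact ⟨s θ x, h2.1 θ (hball hθ), h1.1 θ hθ⟩
  have htaylor : ∀ᵐ x ∂ν, ∀ θ ∈ Metric.ball θ₀ ε₀,
      |ℓ θ x - ℓ θ₀ x - S x * (θ - θ₀) - D x * (θ - θ₀) ^ 2 / 2| ≤ G x * |θ - θ₀| ^ 3 := by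
    filter_upwards [hGG, hsm] with x h1 h2 θ hθ
    have h4 := mvt_ball (h := fun t => ℓ t x - S x * (t - θ₀) - D x * (t - θ₀) ^ 2 / 2)
      (h' := fun t => s t x - S x - D x * (t - θ₀)) (M := G x * (θ - θ₀) ^ 2)
      (fun t ht => by
        have e1 := (hasDerivAt_id' t).sub_const θ₀
        have e2 := ((h2.1 t (hball ht)).fun_sub (e1.const_mul (S x))).fun_sub
          (((e1.fun_pow 2).const_mul (D x)).div_const 2)
        refine e2.congr_deriv ?_
        push_cast
        ring) hθ
      (fun t ht ht2 => by
        refine (h1.1 t ht).trans ?_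
        have := hG0 x
        rw [← sq_abs (t - θ₀), ← sq_abs (θ - θ₀)]
        gcongr)
    have e : ℓ θ x - ℓ θ₀ x - S x * (θ - θ₀) - D x * (θ - θ₀) ^ 2 / 2 =
      (ℓ θ x - S x * (θ - θ₀) - D x * (θ - θ₀) ^ 2 / 2) -
      (ℓ θ₀ x - S x * (θ₀ - θ₀) - D x * (θ₀ - θ₀) ^ 2 / 2) := by ring
    rw [e]
    refine h4.trans (le_of_eq ?_)
    rw [← sq_abs]; ring
  have hexpf : ∀ θ ∈ K, ∀ x, f θ₀ x * Real.exp (ℓ θ x - ℓ θ₀ x) = f θ x := by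
    intro θ hθ x
    rw [Real.exp_sub, hℓdef]
    simp only
    rw [Real.exp_log (hf_pos θ hθ x), Real.exp_log (hf_pos θ₀ hθ₀K x)]
    have := (hf_pos θ₀ hθ₀K x).ne'
    field_simp
  have hone : ∀ θ ∈ K, ∫ x, Real.exp (ℓ θ x - ℓ θ₀ x) ∂ν = 1 := by
    intro θ hθ
    rw [hwint]
    simp only [hexpf θ hθ]
    exact hf_prob θ hθ
  have hkl : ∀ θ ∈ K, θ ≠ θ₀ → ∫ x, (ℓ θ x - ℓ θ₀ x) ∂ν < 0 := by
    intro θ hθ hne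
    have hEE : ExpInt ν (fun x => ℓ θ x - ℓ θ₀ x) := by
      refine hHE.of_le ((hℓ θ hθ).sub (hℓ θ₀ hθ₀K)).aemeasurable (c := |θ - θ₀|) (d := 0)
        (abs_nonneg _) ?_
      filter_upwards [hlip] with x hx
      rw [abs_of_nonneg (hH0 x), add_zero, mul_comm]
      exact hx θ hθ θ₀ hθ₀K
    refine kl_neg (hEE.integrable ((hℓ θ hθ).sub (hℓ θ₀ hθ₀K)).aemeasurable) ?_ (hone θ hθ) ?_
    · by_contra hcon
      have := hone θ hθ
      rw [integral_undef hcon] at this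
      exact zero_ne_one this
    · intro h0
      apply hne
      refine hident θ hθ θ₀ hθ₀K ?_
      have h0' : ∀ᵐ x ∂μ, ℓ θ x - ℓ θ₀ x = 0 := hμν h0
      filter_upwards [h0'] with x hx
      exact Real.log_injOn_pos (hf_pos θ hθ x) (hf_pos θ₀ hθ₀K x) (sub_eq_zero.1 hx)
  have hDint : ∫ x, D x ∂ν = - IFi := by
    rw [← integral_congr_ae hDe, hwint, hIFi, neg_neg]
    simp only [mul_comm]
  have hid : ∫ x, S x ∂ν = 0 ∧ ∫ x, S x ^ 2 ∂ν = - ∫ x, D x ∂ν := by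
    obtain ⟨a, ha, hai⟩ := hHE
    simp only [abs_of_nonneg (hH0 _)] at hai
    set c : ℝ := min (a / 2) (ε₀ / 2) with hc
    have hc0 : 0 < c := lt_min (by positivity) (by positivity)
    set δ : ℕ → ℝ := fun n => c * (1 / ((n : ℝ) + 1)) with hδ
    have hδ0 : ∀ n, 0 < δ n := fun n => by positivity
    have hδc : ∀ n, δ n ≤ c := fun n => by
      refine mul_le_of_le_one_right hc0.le ?_
      rw [div_le_one (by positivity)]
      have : (0:ℝ) ≤ n := Nat.cast_nonneg n
      linarith
    have hmemb : ∀ n, θ₀ + δ n ∈ Metric.ball θ₀ ε₀ := fun n => by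
      rw [Metric.mem_ball, Real.dist_eq, add_sub_cancel_left, abs_of_pos (hδ0 n)]
      have := min_le_right (a / 2) (ε₀ / 2)
      linarith [hδc n]
    have hmemK : ∀ n, θ₀ + δ n ∈ K := fun n => hΘK (hball (hmemb n))
    refine score_ident (u := fun n x => ℓ (θ₀ + δ n) x - ℓ θ₀ x) (δ := δ) (G := G) (H0 := H0) ha
      hSm.aemeasurable
      (fun n => ((hℓ _ (hmemK n)).sub (hℓ θ₀ hθ₀K)).aemeasurable) hH0 hG0 hai
      (hSE.integrable hSm.aemeasurable) (hDE.integrable hDm.aemeasurable)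
      (hGE.integrable hGm.aemeasurable) ?_ hδ0 (fun n => (hδc n).trans (min_le_left _ _)) ?_ ?_ ?_
      (fun n => hone _ (hmemK n))
    · simpa using hSE.integrable_pow hSm.aemeasurable 2
    · simpa [hδ] using (tendsto_one_div_add_atTop_nhds_zero_nat (𝕜 := ℝ)).const_mul c
    · filter_upwards [hlip] with x hx n
      have := hx _ (hmemK n) θ₀ hθ₀K
      rwa [add_sub_cancel_left, abs_of_pos (hδ0 n)] at this
    · filter_upwards [htaylor] with x hx n
      have := hx _ (hmemb n)
      rwa [add_sub_cancel_left, abs_of_pos (hδ0 n)] at this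
  have hS2 : ∫ x, S x ^ 2 ∂ν = IFi := by rw [hid.2, hDint, neg_neg]
  exact mle_abstract hX_meas hX_indep hX_law hKcpt hB hε₀ (hball.trans hΘK) hℓ hHm hH0 hHE hlip hkl
    hSm hDm hGm hG0 hSE hDE hGE hIFi_pos hid.1 hS2 hDint hexp hθhat_meas hθhat_mem hθhat_max hZ m
end
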